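/- arXiv:math/0102101 — 2 statements merged into one kernel-verified Lean document; each statement's English description precedes it below -/
import Mathlib

section
/- Let K be a field of characteristic 2, let m >= 4, and let G be the group of order 2^m with presentation <a, c, d | a^{2^{m-2}} = c^2 = d^2 = 1, (d,a) = (d,c) = 1, (c,a) = d>. Then the group algebra KG has a filtered multiplicative K-basis. -/
/-- `B` is a *filtered multiplicative `K`-basis* of the `K`-algebra `A`:
(0) `B` is a `K`-basis of `A` (linearly independent and spanning);
(1) the product of two elements of `B` is either `0` or again an element of `B`;
(2) `B ∩ rad(A)` is a `K`-basis of the Jacobson radical `rad(A)` of `A`. -/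
def IsFilteredMultiplicativeBasis (K : Type*) {A : Type*} [Field K] [Ring A] [Algebra K A]
    (B : Set A) : Prop :=
  LinearIndependent K ((↑) : B → A) ∧
  Submodule.span K B = ⊤ ∧
  (∀ b₁ ∈ B, ∀ b₂ ∈ B, b₁ * b₂ = 0 ∨ b₁ * b₂ ∈ B) ∧
  LinearIndependent K ((↑) : ↥(B ∩ (((⊥ : Ideal A).jacobson : Ideal A) : Set A)) → A) ∧
  Submodule.span K (B ∩ (((⊥ : Ideal A).jacobson : Ideal A) : Set A)) =
    Submodule.restrictScalars K ((⊥ : Ideal A).jacobson)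

section RadicalMembership

variable {A : Type*} [Ring A]

theorem Ideal.mem_jacobson_bot_of_isNilpotent_of_commute {z : A} (hz : IsNilpotent z)
    (hcomm : ∀ r, Commute z r) : z ∈ (⊥ : Ideal A).jacobson := by
  rw [Ideal.mem_jacobson_iff]
  intro r
  have hnil : IsNilpotent (r * z) := (hcomm r).symm.isNilpotent_mul_left hz
  obtain ⟨u, hu⟩ := hnil.isUnit_one_add
  refine ⟨↑u⁻¹, ?_⟩
  have h : (↑u⁻¹ : A) * (1 + r * z) = 1 := by rw [← hu, Units.inv_mul]
  rw [Ideal.mem_bot, ← h]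
  noncomm_ring

theorem Ideal.mem_jacobson_bot_of_sq_mem {x : A}
    (h : ∀ r, (r * x) * (r * x) ∈ (⊥ : Ideal A).jacobson) : x ∈ (⊥ : Ideal A).jacobson := by
  rw [Ideal.mem_jacobson_iff]
  intro r
  obtain ⟨w, hw⟩ := Ideal.mem_jacobson_iff.1 (h r) (-1)
  refine ⟨w * (1 - r * x), ?_⟩
  rw [Ideal.mem_bot] at hw ⊢
  rw [← hw]
  noncomm_ring

/-- An element whose square is central and nilpotent, and which commutes with everything modulo a
central nilpotent element, lies in the Jacobson radical. -/
theorem Ideal.mem_jacobson_bot_of_commute_mod {x z : A} (hx : IsNilpotent (x * x))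
    (hxc : ∀ r, Commute (x * x) r) (hz : IsNilpotent z) (hzc : ∀ r, Commute z r)
    (hxz : ∀ r, ∃ s, x * r = r * x + z * s) : x ∈ (⊥ : Ideal A).jacobson := by
  refine Ideal.mem_jacobson_bot_of_sq_mem fun r => ?_
  obtain ⟨s, hs⟩ := hxz r
  have key : (r * x) * (r * x) = r * r * (x * x) + r * s * x * z := by
    calc (r * x) * (r * x) = r * (x * r) * x := by noncomm_ring
      _ = r * r * (x * x) + r * (z * (s * x)) := by rw [hs]; noncomm_ring
      _ = _ := by rw [(hzc (s * x)).eq]; noncomm_ring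
  rw [key]
  exact add_mem
    (Ideal.mul_mem_left _ _ (Ideal.mem_jacobson_bot_of_isNilpotent_of_commute hx hxc))
    (Ideal.mul_mem_left _ _ (Ideal.mem_jacobson_bot_of_isNilpotent_of_commute hz hzc))

end RadicalMembership

section Adjoin

variable {K A : Type*} [Field K] [Ring A] [Algebra K A]

theorem commute_of_adjoin_eq_top {S : Set A} (hS : Algebra.adjoin K S = ⊤) {z : A}
    (h : ∀ s ∈ S, Commute z s) (r : A) : Commute z r := by
  have hr : r ∈ Algebra.adjoin K S := hS ▸ Algebra.mem_top
  exact Algebra.commute_of_mem_adjoin_of_forall_mem_commute hr fun s hs => h s hs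

theorem commute_mod_of_adjoin_eq_top {S : Set A} (hS : Algebra.adjoin K S = ⊤) {x z : A}
    (hz : ∀ r, Commute z r) (h : ∀ r ∈ S, ∃ s, x * r = r * x + z * s) (r : A) :
    ∃ s, x * r = r * x + z * s := by
  have hr : r ∈ Algebra.adjoin K S := hS ▸ Algebra.mem_top
  induction hr using Algebra.adjoin_induction with
  | mem r hr => exact h r hr
  | algebraMap k => exact ⟨0, by rw [mul_zero, add_zero, Algebra.commutes]⟩
  | add r₁ r₂ _ _ h₁ h₂ =>
    obtain ⟨s₁, h₁⟩ := h₁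
    obtain ⟨s₂, h₂⟩ := h₂
    exact ⟨s₁ + s₂, by rw [mul_add, h₁, h₂]; noncomm_ring⟩
  | mul r₁ r₂ _ _ h₁ h₂ =>
    obtain ⟨s₁, h₁⟩ := h₁
    obtain ⟨s₂, h₂⟩ := h₂
    refine ⟨r₁ * s₂ + s₁ * r₂, ?_⟩
    calc x * (r₁ * r₂) = x * r₁ * r₂ := by noncomm_ring
      _ = r₁ * (x * r₂) + z * s₁ * r₂ := by rw [h₁]; noncomm_ring
      _ = r₁ * r₂ * x + r₁ * z * s₂ + z * s₁ * r₂ := by rw [h₂]; noncomm_ring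
      _ = _ := by rw [(hz r₁).symm.eq]; noncomm_ring

end Adjoin

section Words

variable {A : Type*} [Ring A]

/-- The alternating words in `x` and `y`, up to the relation `xyxy = yxyx`. -/
def alternatingWord (x y : A) : Fin 8 → A :=
  ![1, x, y, x * y, y * x, x * y * x, y * x * y, x * y * x * y]

theorem mul_alternatingWord_left (x y : A) (j : Fin 8) :
    ∃ e k, x * alternatingWord x y j = (x * x) ^ (e : ℕ) * alternatingWord x y k := by
  fin_cases j
  · exact ⟨0, 1, by simp [alternatingWord]⟩
  · exact ⟨1, 0, by simp [alternatingWord]⟩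
  · exact ⟨0, 3, by simp [alternatingWord]⟩
  · exact ⟨1, 2, by simp [alternatingWord, mul_assoc]⟩
  · exact ⟨0, 5, by simp [alternatingWord, mul_assoc]⟩
  · exact ⟨1, 4, by simp [alternatingWord, mul_assoc]⟩
  · exact ⟨0, 7, by simp [alternatingWord, mul_assoc]⟩
  · exact ⟨1, 6, by simp [alternatingWord, mul_assoc]⟩

theorem mul_alternatingWord_right {x y : A} (hy : y * y = 0)
    (hw : x * y * x * y = y * x * y * x) (j : Fin 8) :
    y * alternatingWord x y j = 0 ∨ ∃ k, y * alternatingWord x y j = alternatingWord x y k := by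
  have hw' : y * (x * (y * x)) = x * (y * (x * y)) := by simpa only [mul_assoc] using hw.symm
  have hyy (w : A) : y * (y * w) = 0 := by rw [← mul_assoc, hy, zero_mul]
  fin_cases j
  · exact .inr ⟨2, by simp [alternatingWord]⟩
  · exact .inr ⟨4, by simp [alternatingWord]⟩
  · exact .inl (by simpa [alternatingWord] using hy)
  · exact .inr ⟨6, by simp [alternatingWord, mul_assoc]⟩
  · exact .inl (by simp [alternatingWord, hyy])
  · exact .inr ⟨7, by simp [alternatingWord, hw', mul_assoc]⟩
  · exact .inl (by simp [alternatingWord, mul_assoc, hyy])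
  · exact .inl (by simp [alternatingWord, ← hw', mul_assoc, hyy])

theorem eq_zero_or_eq_pow_mul_alternatingWord {x y : A} {N : ℕ} (hx : (x * x) ^ N = 0)
    (hy : y * y = 0) (hxy : Commute (x * x) y) (hw : x * y * x * y = y * x * y * x) {b : A}
    (hb : b ∈ Submonoid.closure {x, y}) :
    b = 0 ∨ ∃ p : Fin N × Fin 8, b = (x * x) ^ (p.1 : ℕ) * alternatingWord x y p.2 := by
  have red (i : ℕ) (j : Fin 8) : (x * x) ^ i * alternatingWord x y j = 0 ∨
      ∃ p : Fin N × Fin 8,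
        (x * x) ^ i * alternatingWord x y j = (x * x) ^ (p.1 : ℕ) * alternatingWord x y p.2 := by
    by_cases hi : i < N
    · exact .inr ⟨(⟨i, hi⟩, j), rfl⟩
    · exact .inl (by rw [pow_eq_zero_of_le (not_lt.1 hi) hx, zero_mul])
  induction hb using Submonoid.closure_induction_left with
  | one => simpa [alternatingWord] using red 0 0
  | mul_left u hu b _ ih =>
    obtain rfl | ⟨⟨i, j⟩, rfl⟩ := ih
    · exact .inl (mul_zero _)
    obtain rfl | rfl := hu
    · have hc : Commute ((u * u) ^ (i : ℕ)) u :=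
        ((Commute.refl u).mul_left (Commute.refl u)).pow_left _
      obtain ⟨e, k, hek⟩ := mul_alternatingWord_left u y j
      simp only
      rw [← mul_assoc, ← hc.eq, mul_assoc, hek, ← mul_assoc, ← pow_add]
      exact red _ _
    · simp only
      rw [← mul_assoc, ← (hxy.pow_left _).eq, mul_assoc]
      obtain h | ⟨k, h⟩ := mul_alternatingWord_right hy hw j
      · exact .inl (by rw [h, mul_zero])
      · rw [h]
        exact red _ _

end Words

section Basis

variable {K A : Type*} [Field K] [Ring A] [Algebra K A]

theorem isFilteredMultiplicativeBasis_of_mem_jacobson [Nontrivial A] {S B : Set A}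
    (hB : B = (Submonoid.closure S : Set A) \ {0}) (hS : Algebra.adjoin K S = ⊤)
    (hrad : ∀ s ∈ S, s ∈ (⊥ : Ideal A).jacobson) (hli : LinearIndependent K ((↑) : B → A)) :
    IsFilteredMultiplicativeBasis K B := by
  subst hB
  have hspan : Submodule.span K ((Submonoid.closure S : Set A) \ {0}) = ⊤ := by
    rw [Submodule.span_sdiff_singleton_zero, ← Algebra.adjoin_eq_span, hS, Algebra.top_toSubmodule]
  have hone : (1 : A) ∉ (⊥ : Ideal A).jacobson := by
    rw [← Ideal.eq_top_iff_one, Ideal.jacobson_eq_top_iff]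
    exact bot_ne_top
  have hmem : ∀ b ∈ Submonoid.closure S, b = 1 ∨ b ∈ (⊥ : Ideal A).jacobson := by
    intro b hb
    induction hb using Submonoid.closure_induction_right with
    | one => exact .inl rfl
    | mul_right b _ s hs _ => exact .inr (Ideal.mul_mem_left _ _ (hrad s hs))
  refine ⟨hli, hspan, ?_, LinearIndepOn.mono (v := id) hli Set.inter_subset_left, le_antisymm ?_ ?_⟩
  · rintro b₁ ⟨h₁, -⟩ b₂ ⟨h₂, -⟩
    by_cases h : b₁ * b₂ = 0
    · exact .inl h
    · exact .inr ⟨mul_mem h₁ h₂, h⟩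
  · rw [Submodule.span_le]
    exact fun b hb => hb.2
  · intro r hr
    have hr' : r ∈ Submodule.span K (insert 1 (((Submonoid.closure S : Set A) \ {0}) ∩
        ((⊥ : Ideal A).jacobson : Set A))) := by
      refine Submodule.span_mono ?_ (hspan ▸ Submodule.mem_top : r ∈ _)
      intro b hb
      exact (hmem b hb.1).imp id fun h => ⟨hb, h⟩
    obtain ⟨k, s, hs, rfl⟩ := Submodule.mem_span_insert.1 hr'
    have hs' : s ∈ (⊥ : Ideal A).jacobson := by
      have : s ∈ Submodule.restrictScalars K ((⊥ : Ideal A).jacobson) :=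
        Submodule.span_le.2 (fun b hb => hb.2) hs
      exact this
    have hk : k • (1 : A) ∈ Submodule.restrictScalars K ((⊥ : Ideal A).jacobson) :=
      (Submodule.add_mem_iff_left (Submodule.restrictScalars K _) hs').1 hr
    obtain rfl : k = 0 := by
      by_contra hk0
      exact hone ((Submodule.smul_mem_iff (Submodule.restrictScalars K _) hk0).1 hk)
    simpa using hs

theorem exists_isFilteredMultiplicativeBasis_of_relations {x y z : A} {N : ℕ}
    (hN : 0 < N) (hdim : Module.finrank K A = N * 8) (hgen : Algebra.adjoin K {x, y} = ⊤)
    (hx : (x * x) ^ N = 0) (hy : y * y = 0) (hxy : Commute (x * x) y)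
    (hw : x * y * x * y = y * x * y * x) (hz : IsNilpotent z) (hzx : Commute z x)
    (hzy : Commute z y) (hcomm : ∃ s, x * y = y * x + z * s) :
    ∃ B : Set A, IsFilteredMultiplicativeBasis K B := by
  have : Nontrivial A := Module.nontrivial_of_finrank_pos (R := K) (by omega)
  have hzc : ∀ r, Commute z r := commute_of_adjoin_eq_top hgen (by simp [hzx, hzy])
  have hxx : ∀ r, Commute (x * x) r := commute_of_adjoin_eq_top hgen
    (by simp [hxy, (Commute.refl x).mul_left (Commute.refl x)])
  have hxrad : x ∈ (⊥ : Ideal A).jacobson :=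
    Ideal.mem_jacobson_bot_of_commute_mod ⟨N, hx⟩ hxx hz hzc <|
      commute_mod_of_adjoin_eq_top hgen hzc <| by
        rintro r (rfl | rfl)
        · exact ⟨0, by simp⟩
        · exact hcomm
  have hyrad : y ∈ (⊥ : Ideal A).jacobson :=
    Ideal.mem_jacobson_bot_of_commute_mod (by simp [hy]) (by simp [hy]) hz hzc <|
      commute_mod_of_adjoin_eq_top hgen hzc <| by
        rintro r (rfl | rfl)
        · obtain ⟨s, hs⟩ := hcomm
          exact ⟨-s, by rw [hs]; noncomm_ring⟩
        · exact ⟨0, by simp⟩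
  refine ⟨_, isFilteredMultiplicativeBasis_of_mem_jacobson rfl hgen (by simp [hxrad, hyrad]) ?_⟩
  have hsub : (Submonoid.closure {x, y} : Set A) \ {0} ⊆ Set.range fun p : Fin N × Fin 8 =>
      (x * x) ^ (p.1 : ℕ) * alternatingWord x y p.2 := by
    rintro b ⟨hb, hb0⟩
    obtain h | ⟨p, rfl⟩ := eq_zero_or_eq_pow_mul_alternatingWord hx hy hxy hw hb
    · exact absurd h hb0
    · exact ⟨p, rfl⟩
  have hfin := (Set.finite_range _).subset hsub
  have := hfin.fintype
  refine linearIndependent_of_top_le_span_of_card_le_finrank ?_ ?_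
  · rw [Subtype.range_coe, Submodule.span_sdiff_singleton_zero, ← Algebra.adjoin_eq_span, hgen,
      Algebra.top_toSubmodule]
  · rw [hdim, ← Nat.card_eq_fintype_card, Nat.card_coe_set_eq]
    refine (Set.ncard_le_ncard hsub (Set.finite_range _)).trans ?_
    rw [← Nat.card_coe_set_eq]
    refine (Finite.card_range_le _).trans ?_
    simp

end Basis

theorem MonoidAlgebra.adjoin_of_image_eq_top {K G : Type*} [Field K] [Group G] [Finite G]
    {T : Set G} (hT : Subgroup.closure T = ⊤) :
    Algebra.adjoin K (MonoidAlgebra.of K G '' T) = ⊤ := by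
  have h (g : G) : MonoidAlgebra.of K G g ∈ Algebra.adjoin K (MonoidAlgebra.of K G '' T) := by
    have hg : g ∈ Submonoid.closure T := by
      rw [← Subgroup.closure_toSubmonoid_of_finite, hT]
      trivial
    induction hg using Submonoid.closure_induction with
    | mem g hg => exact Algebra.subset_adjoin ⟨g, hg, rfl⟩
    | one => rw [map_one]; exact one_mem _
    | mul g h _ _ hg hh => rw [map_mul]; exact mul_mem hg hh
  refine Algebra.eq_top_iff.2 fun r => ?_
  induction r using MonoidAlgebra.induction_on with
  | of g => exact h g
  | add f g hf hg => exact add_mem hf hg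
  | smul k f hf => exact Subalgebra.smul_mem _ hf k

/-- The group `G₅ = ⟨a, c, d ∣ a^(2^(m-2)) = c² = d² = 1, (d,a) = (d,c) = 1, (c,a) = d⟩` of order `2^m`, `m ≥ 4`: in characteristic `2`, `KG` has a filtered multiplicative `K`-basis. -/
theorem filtered_mult_basis_G5 (K : Type*) [Field K] [CharP K 2] (m : ℕ) (hm : 4 ≤ m)
    (G : Type*) [Group G] [Fintype G] (hcard : Nat.card G = 2 ^ m)
    (a c d : G) (hgen : Subgroup.closure {a, c, d} = (⊤ : Subgroup G))
    (ha : a ^ 2 ^ (m - 2) = 1) (hc : c ^ 2 = 1) (hd : d ^ 2 = 1)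
    (hda : d⁻¹ * a⁻¹ * d * a = 1) (hdc : d⁻¹ * c⁻¹ * d * c = 1)
    (hca : c⁻¹ * a⁻¹ * c * a = d) :
    ∃ B : Set (MonoidAlgebra K G), IsFilteredMultiplicativeBasis K B := by
  set α := MonoidAlgebra.of K G a with hα
  set γ := MonoidAlgebra.of K G c with hγ
  set δ := MonoidAlgebra.of K G d with hδ
  have : CharP (MonoidAlgebra K G) 2 := charP_of_injective_algebraMap' K 2
  have two (r : MonoidAlgebra K G) : r + r = 0 := CharTwo.add_self_eq_zero r
  have gda : d * a = a * d := by
    simpa [mul_assoc, inv_mul_eq_iff_eq_mul] using hda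
  have gdc : d * c = c * d := by
    simpa [mul_assoc, inv_mul_eq_iff_eq_mul] using hdc
  have gca : c * a = a * c * d := by
    simpa [mul_assoc, inv_mul_eq_iff_eq_mul] using hca
  have hδα : δ * α = α * δ := by rw [hδ, hα, ← map_mul, ← map_mul, gda]
  have hδγ : δ * γ = γ * δ := by rw [hδ, hγ, ← map_mul, ← map_mul, gdc]
  have hγα : γ * α = α * γ * δ := by rw [hδ, hγ, hα, ← map_mul, ← map_mul, ← map_mul, gca]
  have hγγ : γ * γ = 1 := by rw [hγ, ← map_mul, ← sq, hc, map_one]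
  have hδδ : δ * δ = 1 := by rw [hδ, ← map_mul, ← sq, hd, map_one]
  have hαpow : α ^ 2 ^ (m - 2) = 1 := by rw [hα, ← map_pow, ha, map_one]
  have hααγ : Commute (α * α) γ := by
    refine Eq.symm ?_
    calc γ * (α * α) = γ * α * α := by noncomm_ring
      _ = α * γ * (δ * α) := by rw [hγα]; noncomm_ring
      _ = α * (γ * α) * δ := by rw [hδα]; noncomm_ring
      _ = α * α * γ * (δ * δ) := by rw [hγα]; noncomm_ring
      _ = α * α * γ := by rw [hδδ, mul_one]
  have hxx : (1 + α) * (1 + α) = 1 + α * α := by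
    calc (1 + α) * (1 + α) = 1 + α * α + (α + α) := by noncomm_ring
      _ = _ := by rw [two, add_zero]
  have hyy : (1 + γ) * (1 + γ) = 0 := by
    calc (1 + γ) * (1 + γ) = 1 + γ * γ + (γ + γ) := by noncomm_ring
      _ = 0 := by rw [two, add_zero, hγγ, two]
  have hzz : (1 + δ) * (1 + δ) = 0 := by
    calc (1 + δ) * (1 + δ) = 1 + δ * δ + (δ + δ) := by noncomm_ring
      _ = 0 := by rw [two, add_zero, hδδ, two]
  have hzα : Commute (1 + δ) α := (Commute.one_left _).add_left hδα
  have hzγ : Commute (1 + δ) γ := (Commute.one_left _).add_left hδγ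
  have hzx : Commute (1 + δ) (1 + α) := (Commute.one_right _).add_right hzα
  have hzy : Commute (1 + δ) (1 + γ) := (Commute.one_right _).add_right hzγ
  have hxy : Commute ((1 + α) * (1 + α)) (1 + γ) := by
    rw [hxx]
    exact (Commute.one_left _).add_left ((Commute.one_right _).add_right hααγ)
  have hcomm : (1 + α) * (1 + γ) = (1 + γ) * (1 + α) + (1 + δ) * (α * γ) := by
    have h : (1 + δ) * (α * γ) = α * γ + γ * α := by
      rw [(hzα.mul_right hzγ).eq, hγα]; noncomm_ring
    calc (1 + α) * (1 + γ) = (1 + γ + α + α * γ) + (γ * α + γ * α) := by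
          rw [two]; noncomm_ring
      _ = _ := by rw [h]; noncomm_ring
  obtain ⟨k, rfl⟩ : ∃ k, m = k + 3 := ⟨m - 3, by omega⟩
  refine exists_isFilteredMultiplicativeBasis_of_relations (x := 1 + α) (y := 1 + γ) (z := 1 + δ)
    (N := 2 ^ k) (by positivity) ?_ ?_ ?_ hyy hxy ?_ ⟨2, by rw [sq, hzz]⟩ hzx hzy ⟨_, hcomm⟩
  · rw [Module.finrank_eq_card_basis (MonoidAlgebra.basis G K), ← Nat.card_eq_fintype_card, hcard,
      pow_add]
    norm_num
  · rw [eq_top_iff, ← MonoidAlgebra.adjoin_of_image_eq_top (K := K) hgen, Algebra.adjoin_le_iff]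
    have hmem {g : MonoidAlgebra K G} (h : 1 + g ∈ Algebra.adjoin K {1 + α, 1 + γ}) :
        g ∈ Algebra.adjoin K {1 + α, 1 + γ} := by
      simpa using sub_mem h (one_mem _)
    have h₁ : α ∈ Algebra.adjoin K {1 + α, 1 + γ} := hmem (Algebra.subset_adjoin (by simp))
    have h₂ : γ ∈ Algebra.adjoin K {1 + α, 1 + γ} := hmem (Algebra.subset_adjoin (by simp))
    have h₃ : δ = γ * α ^ (2 ^ (k + 1) - 1) * γ * α := by
      have hc' : c⁻¹ = c := inv_eq_of_mul_eq_one_left (by rw [← sq, hc])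
      have ha' : a⁻¹ = a ^ (2 ^ (k + 1) - 1) := by
        refine inv_eq_of_mul_eq_one_left ?_
        rw [← pow_succ, Nat.sub_add_cancel Nat.one_le_two_pow]
        exact ha
      rw [hδ, ← hca, map_mul, map_mul, map_mul, hc', ha', map_pow]
    rintro _ ⟨g, rfl | rfl | rfl, rfl⟩
    · exact h₁
    · exact h₂
    · change δ ∈ _
      rw [h₃]
      exact mul_mem (mul_mem (mul_mem h₂ (pow_mem h₁ _)) h₂) h₁
  · rw [← sq, ← pow_mul, ← pow_succ', add_pow_char_pow_of_commute _ _ (Commute.one_left α), one_pow,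
      show k + 1 = k + 3 - 2 by omega, hαpow, two]
  · generalize 1 + α = x at *
    generalize 1 + γ = y at *
    have hPQ : x * y * (y * x) = 0 := by
      rw [mul_assoc, ← mul_assoc y, hyy, zero_mul, mul_zero]
    have hQP : y * x * (x * y) = 0 := by
      rw [mul_assoc, ← mul_assoc x, hxy.eq, ← mul_assoc, hyy, zero_mul]
    have hs : x * y + y * x = (1 + δ) * (α * γ) := by
      rw [hcomm, add_right_comm, two, zero_add]
    have hsum : (x * y + y * x) * (x * y + y * x) = 0 := by
      rw [hs]
      nth_rewrite 2 [(hzα.mul_right hzγ).eq]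
      rw [(hzα.mul_right hzγ).eq, mul_assoc, ← mul_assoc (1 + δ), (hzα.mul_right hzγ).eq,
        mul_assoc (α * γ) (1 + δ), hzz, mul_zero, mul_zero]
    have hsq : x * y * x * y + y * x * y * x = 0 := by
      calc _ = (x * y + y * x) * (x * y + y * x) - x * y * (y * x) - y * x * (x * y) := by
            noncomm_ring
        _ = 0 := by rw [hsum, hPQ, hQP, sub_zero, sub_zero]
    exact CharTwo.add_eq_zero.1 hsq
end

section
/- Let K be a field of characteristic 2, let m >= 5, and let G be the group of order 2^m with presentation <a, c, d | a^{2^{m-2}} = c^2 = d^2 = 1, (d,c) = 1, (d,a) = a^{2^{m-3}}, (c,a) = a^{2 + 2^{m-3}}>. Then the group algebra KG does not have a filtered multiplicative K-basis. -/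
/-- The associative algebra with basis `1, x, y, w, x², xy, xw, yw`, where `y² = w² = 0`,
`yx = xy + x²`, `w` is central and all products of three of the generators `x, y, w` vanish. -/
@[ext]
structure QuadAlg (K : Type*) where
  /-- The coefficient of `1`. -/
  e : K
  /-- The coefficient of `x`. -/
  x : K
  /-- The coefficient of `y`. -/
  y : K
  /-- The coefficient of `w`. -/
  w : K
  /-- The coefficient of `x²`. -/
  xx : K
  /-- The coefficient of `xy`. -/
  xy : K
  /-- The coefficient of `xw`. -/
  xw : K
  /-- The coefficient of `yw`. -/
  yw : K

namespace QuadAlg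

section Ring

variable {K : Type*} [CommRing K]

instance : Zero (QuadAlg K) := ⟨⟨0, 0, 0, 0, 0, 0, 0, 0⟩⟩

instance : One (QuadAlg K) := ⟨⟨1, 0, 0, 0, 0, 0, 0, 0⟩⟩

instance : Add (QuadAlg K) := ⟨fun p q => ⟨p.e + q.e, p.x + q.x, p.y + q.y, p.w + q.w,
  p.xx + q.xx, p.xy + q.xy, p.xw + q.xw, p.yw + q.yw⟩⟩

instance : Neg (QuadAlg K) := ⟨fun p => ⟨-p.e, -p.x, -p.y, -p.w, -p.xx, -p.xy, -p.xw, -p.yw⟩⟩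

instance : Mul (QuadAlg K) := ⟨fun p q => ⟨p.e * q.e,
  p.e * q.x + p.x * q.e, p.e * q.y + p.y * q.e, p.e * q.w + p.w * q.e,
  p.e * q.xx + p.xx * q.e + (p.x + p.y) * q.x,
  p.e * q.xy + p.xy * q.e + (p.x * q.y + p.y * q.x),
  p.e * q.xw + p.xw * q.e + (p.x * q.w + p.w * q.x),
  p.e * q.yw + p.yw * q.e + (p.y * q.w + p.w * q.y)⟩⟩

@[simp] lemma zero_def : (0 : QuadAlg K) = ⟨0, 0, 0, 0, 0, 0, 0, 0⟩ := rfl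

@[simp] lemma one_def : (1 : QuadAlg K) = ⟨1, 0, 0, 0, 0, 0, 0, 0⟩ := rfl

@[simp] lemma add_def (p q : QuadAlg K) : p + q = ⟨p.e + q.e, p.x + q.x, p.y + q.y, p.w + q.w,
  p.xx + q.xx, p.xy + q.xy, p.xw + q.xw, p.yw + q.yw⟩ := rfl

@[simp] lemma neg_def (p : QuadAlg K) :
    -p = ⟨-p.e, -p.x, -p.y, -p.w, -p.xx, -p.xy, -p.xw, -p.yw⟩ := rfl

@[simp] lemma mul_def (p q : QuadAlg K) : p * q = ⟨p.e * q.e,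
  p.e * q.x + p.x * q.e, p.e * q.y + p.y * q.e, p.e * q.w + p.w * q.e,
  p.e * q.xx + p.xx * q.e + (p.x + p.y) * q.x,
  p.e * q.xy + p.xy * q.e + (p.x * q.y + p.y * q.x),
  p.e * q.xw + p.xw * q.e + (p.x * q.w + p.w * q.x),
  p.e * q.yw + p.yw * q.e + (p.y * q.w + p.w * q.y)⟩ := rfl

instance : Ring (QuadAlg K) where
  add_assoc p q r := by ext <;> simp <;> ring
  zero_add p := by ext <;> simp
  add_zero p := by ext <;> simp
  add_comm p q := by ext <;> simp <;> ring
  neg_add_cancel p := by ext <;> simp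
  mul_assoc p q r := by ext <;> simp <;> ring
  one_mul p := by ext <;> simp
  mul_one p := by ext <;> simp
  left_distrib p q r := by ext <;> simp <;> ring
  right_distrib p q r := by ext <;> simp <;> ring
  zero_mul p := by ext <;> simp
  mul_zero p := by ext <;> simp
  nsmul := nsmulRec
  zsmul := zsmulRec

@[simp] lemma sub_def (p q : QuadAlg K) : p - q = ⟨p.e - q.e, p.x - q.x, p.y - q.y, p.w - q.w,
    p.xx - q.xx, p.xy - q.xy, p.xw - q.xw, p.yw - q.yw⟩ := by
  rw [sub_eq_add_neg]
  ext <;> simp [sub_eq_add_neg]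

/-- The inclusion of the scalars. -/
def scalar : K →+* QuadAlg K where
  toFun k := ⟨k, 0, 0, 0, 0, 0, 0, 0⟩
  map_one' := rfl
  map_mul' _ _ := by ext <;> simp
  map_zero' := rfl
  map_add' _ _ := by ext <;> simp

instance : Algebra K (QuadAlg K) :=
  scalar.toAlgebra' fun k p => by ext <;> simp [scalar] <;> ring

@[simp] lemma smul_def (k : K) (p : QuadAlg K) : k • p = ⟨k * p.e, k * p.x, k * p.y, k * p.w,
    k * p.xx, k * p.xy, k * p.xw, k * p.yw⟩ := by
  rw [Algebra.smul_def]
  change scalar k * p = _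
  ext <;> simp [scalar]

/-- The augmentation of `QuadAlg K`. -/
def aug : QuadAlg K →ₐ[K] K where
  toFun p := p.e
  map_one' := rfl
  map_mul' _ _ := rfl
  map_zero' := rfl
  map_add' _ _ := rfl
  commutes' _ := rfl

lemma aug_apply (p : QuadAlg K) : aug p = p.e := rfl

end Ring

end QuadAlg

section NormalForm

variable {H : Type*} [Group H] {a c d : H} {r s : ℤ}

/-- A group generated by a normal cyclic group `⟨a⟩` and two commuting involutions consists of the
products `a ^ i * c ^ j * d ^ k`. -/
lemma exists_eq_zpow_mul (hc : c * c = 1) (hd : d * d = 1) (hdc : d * c = c * d)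
    (hda : d * a = a ^ r * d) (hca : c * a = a ^ s * c) {g : H}
    (hg : g ∈ Subgroup.closure {a, c, d}) :
    ∃ (i : ℤ) (j k : Fin 2), g = a ^ i * c ^ (j : ℕ) * d ^ (k : ℕ) := by
  have hda' (i : ℤ) : d * a ^ i = a ^ (r * i) * d := by
    have h : SemiconjBy d a (a ^ r) := hda
    rw [zpow_mul]; exact h.zpow_right i
  have hca' (i : ℤ) : c * a ^ i = a ^ (s * i) * c := by
    have h : SemiconjBy c a (a ^ s) := hca
    rw [zpow_mul]; exact h.zpow_right i
  have hcl (g : H) (hg : ∃ (i : ℤ) (j k : Fin 2), g = a ^ i * c ^ (j : ℕ) * d ^ (k : ℕ)) :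
      ∃ (i : ℤ) (j k : Fin 2), c * g = a ^ i * c ^ (j : ℕ) * d ^ (k : ℕ) := by
    obtain ⟨i, j, k, rfl⟩ := hg
    refine ⟨s * i, j + 1, k, ?_⟩
    rw [← mul_assoc, ← mul_assoc, hca']
    fin_cases j <;> simp [mul_assoc, hc]
  have hdl (g : H) (hg : ∃ (i : ℤ) (j k : Fin 2), g = a ^ i * c ^ (j : ℕ) * d ^ (k : ℕ)) :
      ∃ (i : ℤ) (j k : Fin 2), d * g = a ^ i * c ^ (j : ℕ) * d ^ (k : ℕ) := by
    obtain ⟨i, j, k, rfl⟩ := hg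
    refine ⟨r * i, j, k + 1, ?_⟩
    have h : Commute d (c ^ (j : ℕ)) := Commute.pow_right hdc _
    rw [← mul_assoc, ← mul_assoc, hda', mul_assoc (a ^ (r * i)), h.eq]
    fin_cases k <;> simp [mul_assoc, hd]
  have hal (n : ℤ) (g : H)
      (hg : ∃ (i : ℤ) (j k : Fin 2), g = a ^ i * c ^ (j : ℕ) * d ^ (k : ℕ)) :
      ∃ (i : ℤ) (j k : Fin 2), a ^ n * g = a ^ i * c ^ (j : ℕ) * d ^ (k : ℕ) := by
    obtain ⟨i, j, k, rfl⟩ := hg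
    exact ⟨n + i, j, k, by simp only [zpow_add, mul_assoc]⟩
  induction hg using Subgroup.closure_induction_left with
  | one => exact ⟨0, 0, 0, by simp⟩
  | mul_left x hx y _ ih =>
    rcases hx with rfl | rfl | rfl
    · simpa using hal 1 y ih
    · exact hcl y ih
    · exact hdl y ih
  | inv_mul_cancel x hx y _ ih =>
    rcases hx with rfl | rfl | rfl
    · simpa using hal (-1) y ih
    · rw [inv_eq_of_mul_eq_one_left hc]; exact hcl y ih
    · rw [inv_eq_of_mul_eq_one_left hd]; exact hdl y ih

lemma card_closure_le {N : ℕ} (hN : 0 < N) (ha : a ^ N = 1) (hc : c * c = 1) (hd : d * d = 1)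
    (hdc : d * c = c * d) (hda : d * a = a ^ r * d) (hca : c * a = a ^ s * c) :
    Finite (Subgroup.closure {a, c, d}) ∧ Nat.card (Subgroup.closure {a, c, d}) ≤ N * 4 := by
  let S : Set H := Set.range fun t : Fin N × Fin 2 × Fin 2 =>
    a ^ (t.1 : ℕ) * c ^ (t.2.1 : ℕ) * d ^ (t.2.2 : ℕ)
  have hsub : (Subgroup.closure {a, c, d} : Set H) ⊆ S := by
    intro g hg
    obtain ⟨i, j, k, rfl⟩ := exists_eq_zpow_mul hc hd hdc hda hca hg
    have h0 : 0 ≤ i % N := Int.emod_nonneg _ (by positivity)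
    have h1 : i % N < N := Int.emod_lt_of_pos _ (by positivity)
    refine ⟨(⟨(i % N).toNat, by omega⟩, j, k), ?_⟩
    have : a ^ (i % N).toNat = a ^ i := by
      rw [← zpow_natCast, Int.toNat_of_nonneg h0]
      conv_rhs => rw [← Int.emod_add_mul_ediv i N, zpow_add, zpow_mul, zpow_natCast, ha]
      simp
    simp [this]
  have hfin : S.Finite := Set.finite_range _
  refine ⟨hfin.subset hsub, ?_⟩
  calc Nat.card (Subgroup.closure {a, c, d}) ≤ Nat.card S := Nat.card_mono hfin hsub
    _ ≤ Nat.card (Fin N × Fin 2 × Fin 2) := Finite.card_range_le _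
    _ = N * 4 := by simp

/-- A finite group which attains the bound of `card_closure_le` has the universal property of the
corresponding presentation. -/
lemma exists_monoidHom_of_card_eq {G : Type*} [Group G] {a c d : G} {a' c' d' : H} {N : ℕ}
    (hN : 0 < N)
    (hcard : Nat.card G = N * 4) (hgen : Subgroup.closure {a, c, d} = (⊤ : Subgroup G))
    (ha : a ^ N = 1) (hc : c * c = 1) (hd : d * d = 1)
    (hdc : d * c = c * d) (hda : d * a = a ^ r * d) (hca : c * a = a ^ s * c)
    (ha' : a' ^ N = 1) (hc' : c' * c' = 1) (hd' : d' * d' = 1)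
    (hdc' : d' * c' = c' * d') (hda' : d' * a' = a' ^ r * d') (hca' : c' * a' = a' ^ s * c') :
    ∃ f : G →* H, f a = a' ∧ f c = c' ∧ f d = d' := by
  let Γ : Subgroup (G × H) := Subgroup.closure {(a, a'), (c, c'), (d, d')}
  obtain ⟨hfin, hle⟩ : Finite Γ ∧ Nat.card Γ ≤ N * 4 :=
    card_closure_le (r := r) (s := s) hN (Prod.ext ha ha') (Prod.ext hc hc') (Prod.ext hd hd')
      (Prod.ext hdc hdc') (Prod.ext hda hda') (Prod.ext hca hca')
  let π : Γ →* G := (MonoidHom.fst G H).comp Γ.subtype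
  have haΓ : (a, a') ∈ Γ := Subgroup.subset_closure (by simp)
  have hcΓ : (c, c') ∈ Γ := Subgroup.subset_closure (by simp)
  have hdΓ : (d, d') ∈ Γ := Subgroup.subset_closure (by simp)
  have hsurj : Function.Surjective π := by
    rw [← MonoidHom.range_eq_top, eq_top_iff, ← hgen, Subgroup.closure_le]
    rintro _ (rfl | rfl | rfl)
    exacts [⟨⟨_, haΓ⟩, rfl⟩, ⟨⟨_, hcΓ⟩, rfl⟩, ⟨⟨_, hdΓ⟩, rfl⟩]
  have hbij : Function.Bijective π :=
    (Nat.bijective_iff_surjective_and_card π).2 ⟨hsurj,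
      le_antisymm (hle.trans hcard.ge) (Nat.card_le_card_of_surjective π hsurj)⟩
  let E : Γ ≃* G := MulEquiv.ofBijective π hbij
  refine ⟨((MonoidHom.snd G H).comp Γ.subtype).comp E.symm.toMonoidHom, ?_, ?_, ?_⟩
  · change (E.symm (E ⟨_, haΓ⟩) : G × H).2 = a'
    rw [E.symm_apply_apply]
  · change (E.symm (E ⟨_, hcΓ⟩) : G × H).2 = c'
    rw [E.symm_apply_apply]
  · change (E.symm (E ⟨_, hdΓ⟩) : G × H).2 = d'
    rw [E.symm_apply_apply]

end NormalForm

section Approximation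

variable {K A : Type*} [Field K] [Ring A] [Algebra K A]

/-- `φ` identifies `A ⧸ J ^ 3` with `QuadAlg K` (see `QuadApprox.mem_sq` and
`QuadApprox.mem_cube`), and `x, y, w` lift the generators of `QuadAlg K`. -/
structure QuadApprox (φ : A →ₐ[K] QuadAlg K) (J : Submodule K A) (x y w : A) : Prop where
  mem_iff : ∀ u, u ∈ J ↔ (φ u).e = 0
  map_x : φ x = ⟨0, 1, 0, 0, 0, 0, 0, 0⟩
  map_y : φ y = ⟨0, 0, 1, 0, 0, 0, 0, 0⟩
  map_w : φ w = ⟨0, 0, 0, 1, 0, 0, 0, 0⟩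
  le_sup : J ≤ Submodule.span K {x, y, w} ⊔ J ^ 2
  yy : y * y = 0
  ww : w * w = 0
  wy : w * y = y * w
  wx : w * x - x * w ∈ J ^ 3
  yx : y * x - x * y - x * x ∈ J ^ 3

namespace QuadApprox

variable {φ : A →ₐ[K] QuadAlg K} {J : Submodule K A} {x y w : A}

lemma x_mem (h : QuadApprox φ J x y w) : x ∈ J := by simp [h.mem_iff, h.map_x]

lemma y_mem (h : QuadApprox φ J x y w) : y ∈ J := by simp [h.mem_iff, h.map_y]

lemma w_mem (h : QuadApprox φ J x y w) : w ∈ J := by simp [h.mem_iff, h.map_w]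

lemma map_sq (h : QuadApprox φ J x y w) {u : A} (hu : u ∈ J ^ 2) :
    (φ u).e = 0 ∧ (φ u).x = 0 ∧ (φ u).y = 0 ∧ (φ u).w = 0 := by
  rw [pow_two] at hu
  induction hu using Submodule.mul_induction_on' with
  | mem_mul_mem p hp q hq => simp [map_mul, (h.mem_iff p).1 hp, (h.mem_iff q).1 hq]
  | add p _ q _ hp hq => simp [map_add, hp, hq]

lemma map_cube (h : QuadApprox φ J x y w) {u : A} (hu : u ∈ J ^ 3) : φ u = 0 := by
  rw [pow_succ] at hu
  induction hu using Submodule.mul_induction_on' with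
  | mem_mul_mem p hp q hq =>
    obtain ⟨h1, h2, h3, h4⟩ := h.map_sq hp
    rw [map_mul]
    ext <;> simp [(h.mem_iff q).1 hq, h1, h2, h3, h4]
  | add p _ q _ hp hq => rw [map_add, hp, hq, add_zero]

lemma sq_le (h : QuadApprox φ J x y w) : J ^ 2 ≤ J := fun u hu =>
  (h.mem_iff u).2 (h.map_sq hu).1

lemma exists_sub_mem_sq (h : QuadApprox φ J x y w) {u : A} (hu : u ∈ J) :
    ∃ α β γ : K, u - (α • x + β • y + γ • w) ∈ J ^ 2 := by
  obtain ⟨v, hv, j, hj, rfl⟩ := Submodule.mem_sup.1 (h.le_sup hu)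
  obtain ⟨α, β, γ, rfl⟩ := Submodule.mem_span_triple.1 hv
  exact ⟨α, β, γ, by simpa using hj⟩

lemma exists_sub_mem_cube (h : QuadApprox φ J x y w) {u : A} (hu : u ∈ J ^ 2) :
    ∃ p q r s : K, u - (p • (x * x) + q • (x * y) + r • (x * w) + s • (y * w)) ∈ J ^ 3 := by
  rw [pow_two] at hu
  induction hu using Submodule.mul_induction_on' with
  | mem_mul_mem m hm n hn =>
    obtain ⟨α, β, γ, hj⟩ := h.exists_sub_mem_sq hm
    obtain ⟨α', β', γ', hj'⟩ := h.exists_sub_mem_sq hn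
    set j := m - (α • x + β • y + γ • w)
    set j' := n - (α' • x + β' • y + γ' • w)
    have hm' : α • x + β • y + γ • w ∈ J :=
      add_mem (add_mem (J.smul_mem _ h.x_mem) (J.smul_mem _ h.y_mem)) (J.smul_mem _ h.w_mem)
    have h1 : j * n ∈ J ^ 3 := by rw [pow_succ]; exact Submodule.mul_mem_mul hj hn
    have h2 : (α • x + β • y + γ • w) * j' ∈ J ^ 3 := by
      rw [pow_succ']; exact Submodule.mul_mem_mul hm' hj'
    refine ⟨α * α' + β * α', α * β' + β * α', α * γ' + γ * α', β * γ' + γ * β', ?_⟩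
    have key : m * n = j * n + (α • x + β • y + γ • w) * j' +
        (α • x + β • y + γ • w) * (α' • x + β' • y + γ' • w) := by
      simp only [j, j']; noncomm_ring
    have expand : (α • x + β • y + γ • w) * (α' • x + β' • y + γ' • w) =
        (α * α' + β * α') • (x * x) + (α * β' + β * α') • (x * y) + (α * γ' + γ * α') • (x * w) +
        (β * γ' + γ * β') • (y * w) + (γ * α') • (w * x - x * w) +
        (β * α') • (y * x - x * y - x * x) := by
      simp only [mul_add, add_mul, smul_mul_smul_comm, h.yy, h.ww, h.wy]
      module
    rw [key, expand]
    have h3 := add_mem (add_mem h1 h2) (add_mem ((J ^ 3).smul_mem (γ * α') h.wx)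
      ((J ^ 3).smul_mem (β * α') h.yx))
    convert h3 using 1
    abel
  | add m _ n _ hm hn =>
    obtain ⟨p, q, r, s, h1⟩ := hm
    obtain ⟨p', q', r', s', h2⟩ := hn
    refine ⟨p + p', q + q', r + r', s + s', ?_⟩
    convert add_mem h1 h2 using 1
    module

lemma mem_sq (h : QuadApprox φ J x y w) {u : A} (hu : u ∈ J) (hx : (φ u).x = 0)
    (hy : (φ u).y = 0) (hw : (φ u).w = 0) : u ∈ J ^ 2 := by
  obtain ⟨α, β, γ, hj⟩ := h.exists_sub_mem_sq hu
  have h0 := h.map_sq hj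
  simp [map_sub, map_add, map_smul, h.map_x, h.map_y, h.map_w, hx, hy, hw] at h0
  obtain ⟨-, rfl, rfl, rfl⟩ := h0
  simpa using hj

lemma mem_cube (h : QuadApprox φ J x y w) {u : A} (hu : u ∈ J ^ 2) (h0 : φ u = 0) :
    u ∈ J ^ 3 := by
  obtain ⟨p, q, r, s, hj⟩ := h.exists_sub_mem_cube hu
  have h1 := h.map_cube hj
  simp [map_sub, map_add, map_smul, map_mul, h.map_x, h.map_y, h.map_w, h0] at h1
  obtain ⟨rfl, rfl, rfl, rfl⟩ := h1
  simpa using hj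

end QuadApprox

/-- A basis `B` of `A` which is closed under products up to `0` and contains a basis of `J`. -/
structure IsAdaptedBasis (B : Set A) (J : Submodule K A) : Prop where
  linearIndependent : LinearIndependent K ((↑) : B → A)
  span_eq_top : Submodule.span K B = ⊤
  mul_eq_zero_or_mem : ∀ b₁ ∈ B, ∀ b₂ ∈ B, b₁ * b₂ = 0 ∨ b₁ * b₂ ∈ B
  span_inter : Submodule.span K (B ∩ J) = J

namespace IsAdaptedBasis

variable {J : Submodule K A} {B : Set A}

lemma span_inter_pow (hB : IsAdaptedBasis B J) (k : ℕ) :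
    Submodule.span K (B ∩ (J ^ (k + 1) : Submodule K A)) = J ^ (k + 1) := by
  refine le_antisymm (Submodule.span_le.2 Set.inter_subset_right) ?_
  induction k with
  | zero => simpa using hB.span_inter.ge
  | succ k ih =>
    rw [pow_succ J (k + 1)]
    calc J ^ (k + 1) * J ≤ Submodule.span K (B ∩ (J ^ (k + 1) : Submodule K A)) *
          Submodule.span K (B ∩ J) := mul_le_mul' ih hB.span_inter.ge
      _ ≤ _ := by
        rw [Submodule.span_mul_span, Submodule.span_le]
        rintro _ ⟨p, ⟨hp, hpJ⟩, q, ⟨hq, hqJ⟩, rfl⟩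
        rcases hB.mul_eq_zero_or_mem p hp q hq with h0 | h1
        · simp [h0]
        · exact Submodule.subset_span ⟨h1, Submodule.mul_mem_mul hpJ hqJ⟩

/-- The coordinate functional of a basis element outside `J ^ (k + 1)` vanishes on
`J ^ (k + 1)`. -/
lemma exists_coord (hB : IsAdaptedBasis B J) (k : ℕ) {b : A} (hb : b ∈ B)
    (hbJ : b ∉ J ^ (k + 1)) :
    ∃ f : A →ₗ[K] K, f b = 1 ∧ (∀ b', b' = 0 ∨ b' ∈ B → b' ≠ b → f b' = 0) ∧
      ∀ u ∈ J ^ (k + 1), f u = 0 := by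
  let β : Module.Basis B K A := Module.Basis.mk hB.linearIndependent (by simp [hB.span_eq_top])
  have hβ (t : B) : β t = t := by simp [β]
  have hf (b' : A) (hb' : b' = 0 ∨ b' ∈ B) (hne : b' ≠ b) : β.coord ⟨b, hb⟩ b' = 0 := by
    rcases hb' with rfl | hb'
    · simp
    · rw [show b' = β ⟨b', hb'⟩ from (hβ ⟨b', hb'⟩).symm, Module.Basis.coord_apply, Module.Basis.repr_self,
        Finsupp.single_eq_of_ne (by simpa using hne.symm)]
  refine ⟨β.coord ⟨b, hb⟩, ?_, hf, fun u hu => ?_⟩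
  · calc β.coord ⟨b, hb⟩ b = β.coord ⟨b, hb⟩ (β ⟨b, hb⟩) := by rw [hβ]
      _ = 1 := by simp
  · rw [← hB.span_inter_pow k] at hu
    induction hu using Submodule.span_induction with
    | mem v hv => exact hf v (Or.inr hv.1) (by rintro rfl; exact hbJ hv.2)
    | zero => simp
    | add p q _ _ hp hq => rw [map_add, hp, hq, add_zero]
    | smul t p _ hp => rw [map_smul, hp, smul_zero]

lemma eq_of_sub_mem (hB : IsAdaptedBasis B J) (k : ℕ) {b b' : A} (hb : b ∈ B)
    (hbJ : b ∉ J ^ (k + 1)) (hb' : b' = 0 ∨ b' ∈ B) (hsub : b - b' ∈ J ^ (k + 1)) : b = b' := by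
  by_contra hne
  obtain ⟨f, h1, h2, h3⟩ := hB.exists_coord k hb hbJ
  have := h3 _ hsub
  rw [map_sub, h1, h2 b' hb' (Ne.symm hne)] at this
  simp at this

end IsAdaptedBasis

/-- The elements of `B` that represent a basis of `J ⧸ J ^ 2`. -/
def adaptedGenerators (B : Set A) (J : Submodule K A) : Set A := {u ∈ B | u ∈ J ∧ u ∉ J ^ 2}

/-- The determinant of the `(x, y)`-coordinates, in characteristic two. -/
def xyDet (φ : A →ₐ[K] QuadAlg K) (u v : A) : K := (φ u).x * (φ v).y + (φ u).y * (φ v).x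

namespace QuadApprox

variable {φ : A →ₐ[K] QuadAlg K} {J : Submodule K A} {x y w : A} {B : Set A}

lemma mul_mem_sq {u v : A} (hu : u ∈ J) (hv : v ∈ J) : u * v ∈ J ^ 2 := by
  rw [pow_two]; exact Submodule.mul_mem_mul hu hv

lemma mem_or_mem_sq {u : A} (hu : u ∈ B ∩ J) : u ∈ adaptedGenerators B J ∨ u ∈ J ^ 2 := by
  by_cases h2 : u ∈ J ^ 2
  · exact Or.inr h2
  · exact Or.inl ⟨hu.1, hu.2, h2⟩

lemma exists_xyDet_ne_zero (h : QuadApprox φ J x y w) (hB : IsAdaptedBasis B J) :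
    ∃ u ∈ adaptedGenerators B J, ∃ v ∈ adaptedGenerators B J, xyDet φ u v ≠ 0 := by
  by_contra! hcon
  have h1 (u : A) (hu : u ∈ B ∩ J) (v : A) (hv : v ∈ B ∩ J) : xyDet φ u v = 0 := by
    rcases mem_or_mem_sq hu with hu | hu
    · rcases mem_or_mem_sq hv with hv | hv
      · exact hcon u hu v hv
      · obtain ⟨-, hx, hy, -⟩ := h.map_sq hv
        simp [xyDet, hx, hy]
    · obtain ⟨-, hx, hy, -⟩ := h.map_sq hu
      simp [xyDet, hx, hy]
  have h2 (u : A) (hu : u ∈ B ∩ J) (v : A) (hv : v ∈ J) : xyDet φ u v = 0 := by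
    rw [← hB.span_inter] at hv
    induction hv using Submodule.span_induction with
    | mem v hv => exact h1 u hu v hv
    | zero => simp [xyDet]
    | add p q _ _ hp hq =>
      simp only [xyDet, map_add, QuadAlg.add_def] at *
      linear_combination hp + hq
    | smul t p _ hp =>
      simp only [xyDet, map_smul, QuadAlg.smul_def] at *
      linear_combination t * hp
  have h3 (u : A) (hu : u ∈ J) : xyDet φ u y = 0 := by
    rw [← hB.span_inter] at hu
    induction hu using Submodule.span_induction with
    | mem u hu => exact h2 u hu y h.y_mem
    | zero => simp [xyDet]
    | add p q _ _ hp hq =>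
      simp only [xyDet, map_add, QuadAlg.add_def] at *
      linear_combination hp + hq
    | smul t p _ hp =>
      simp only [xyDet, map_smul, QuadAlg.smul_def] at *
      linear_combination t * hp
  have := h3 x h.x_mem
  simp [xyDet, h.map_x, h.map_y] at this

lemma exists_third (h : QuadApprox φ J x y w) (hB : IsAdaptedBasis B J) [CharP K 2] {u₁ u₂ : A}
    (hdet : xyDet φ u₁ u₂ ≠ 0) : ∃ u ∈ adaptedGenerators B J, u ≠ u₁ ∧ u ≠ u₂ := by
  by_contra! hcon
  have h2 : (2 : K) = 0 := CharTwo.two_eq_zero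
  have h1 (u : A) (hu : u ∈ J) : xyDet φ u₁ u₂ * (φ u).w +
      ((φ u₁).y * (φ u₂).w + (φ u₁).w * (φ u₂).y) * (φ u).x +
      ((φ u₁).x * (φ u₂).w + (φ u₁).w * (φ u₂).x) * (φ u).y = 0 := by
    rw [← hB.span_inter] at hu
    induction hu using Submodule.span_induction with
    | mem u hu =>
      rcases mem_or_mem_sq hu with hu | hu
      · by_cases h12 : u = u₁
        · subst h12
          simp only [xyDet]
          linear_combination ((φ u).x * (φ u).y * (φ u₂).w + (φ u).x * (φ u).w * (φ u₂).y +
            (φ u).y * (φ u).w * (φ u₂).x) * h2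
        · obtain rfl := hcon u hu h12
          simp only [xyDet]
          linear_combination ((φ u).x * (φ u).y * (φ u₁).w + (φ u).x * (φ u).w * (φ u₁).y +
            (φ u).y * (φ u).w * (φ u₁).x) * h2
      · obtain ⟨-, hx, hy, hw⟩ := h.map_sq hu
        simp [hx, hy, hw]
    | zero => simp
    | add p q _ _ hp hq =>
      simp only [map_add, QuadAlg.add_def] at *
      linear_combination hp + hq
    | smul t p _ hp =>
      simp only [map_smul, QuadAlg.smul_def] at *
      linear_combination t * hp
  have := h1 w h.w_mem
  simp [h.map_w] at this
  exact hdet this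

lemma map_mul_of_mem (h : QuadApprox φ J x y w) {u v : A} (hu : u ∈ J) (hv : v ∈ J) :
    φ (u * v) = ⟨0, 0, 0, 0, ((φ u).x + (φ u).y) * (φ v).x,
      (φ u).x * (φ v).y + (φ u).y * (φ v).x, (φ u).x * (φ v).w + (φ u).w * (φ v).x,
      (φ u).y * (φ v).w + (φ u).w * (φ v).y⟩ := by
  simp [map_mul, (h.mem_iff u).1 hu, (h.mem_iff v).1 hv]

lemma notMem_cube_of_xy_ne_zero (h : QuadApprox φ J x y w) {p : A} (hp : (φ p).xy ≠ 0) :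
    p ∉ J ^ 3 := fun h3 => hp (by rw [h.map_cube h3]; rfl)

/-- Products of two elements of `J` that agree under `φ` agree modulo `J ^ 3`, hence coincide if
they lie in the basis. -/
lemma eq_of_map_eq (h : QuadApprox φ J x y w) (hB : IsAdaptedBasis B J) {p q : A}
    (hp : p ∈ B) (hp2 : p ∈ J ^ 2) (hp0 : φ p ≠ 0) (hq : q = 0 ∨ q ∈ B) (hq2 : q ∈ J ^ 2)
    (hpq : φ p = φ q) : p = q :=
  hB.eq_of_sub_mem 2 hp (fun h3 => hp0 (h.map_cube h3)) hq
    (h.mem_cube (sub_mem hp2 hq2) (by rw [map_sub, hpq, sub_self]))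

lemma mul_mem_of_xyDet_ne_zero (h : QuadApprox φ J x y w) (hB : IsAdaptedBasis B J) {u v : A}
    (hu : u ∈ adaptedGenerators B J) (hv : v ∈ adaptedGenerators B J) (hdet : xyDet φ u v ≠ 0) :
    u * v ∈ B ∧ u * v ∉ J ^ 3 := by
  have h3 : u * v ∉ J ^ 3 := h.notMem_cube_of_xy_ne_zero (by
    rw [h.map_mul_of_mem hu.2.1 hv.2.1]; exact hdet)
  refine ⟨(hB.mul_eq_zero_or_mem u hu.1 v hv.1).resolve_left fun h0 => h3 ?_, h3⟩
  rw [h0]; exact zero_mem _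

lemma xyDet_comm (u v : A) : xyDet φ u v = xyDet φ v u := by
  simp only [xyDet]; ring

lemma mul_ne_mul_of_xyDet_ne_zero (h : QuadApprox φ J x y w) [CharP K 2] {u v : A}
    (hu : u ∈ J) (hv : v ∈ J) (hdet : xyDet φ u v ≠ 0) : v * u ≠ u * v := by
  intro heq
  have := congrArg QuadAlg.xx (congrArg φ heq)
  rw [h.map_mul_of_mem hu hv, h.map_mul_of_mem hv hu] at this
  have h2 : (2 : K) = 0 := CharTwo.two_eq_zero
  apply hdet
  simp only [xyDet] at *
  linear_combination this + (φ u).y * (φ v).x * h2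

lemma square_coeff_eq_zero (h : QuadApprox φ J x y w) (hB : IsAdaptedBasis B J) [CharP K 2]
    {u₁ u₂ u : A} (h₁ : u₁ ∈ adaptedGenerators B J) (h₂ : u₂ ∈ adaptedGenerators B J)
    (hdet : xyDet φ u₁ u₂ ≠ 0) (hu : u ∈ adaptedGenerators B J) :
    ((φ u).x + (φ u).y) * (φ u).x = 0 := by
  have h2 : (2 : K) = 0 := CharTwo.two_eq_zero
  obtain ⟨hb, hb3⟩ := h.mul_mem_of_xyDet_ne_zero hB h₁ h₂ hdet
  obtain ⟨f, f1, f2, f3⟩ := hB.exists_coord 2 hb hb3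
  have hne : u * u ≠ u₁ * u₂ := by
    intro heq
    have := congrArg QuadAlg.xy (congrArg φ heq)
    rw [h.map_mul_of_mem h₁.2.1 h₂.2.1, h.map_mul_of_mem hu.2.1 hu.2.1] at this
    apply hdet
    simp only [xyDet] at *
    linear_combination -this + (φ u).x * (φ u).y * h2
  have hmem : (((φ u).x + (φ u).y) * (φ u).x) • (u₁ * u₂ - u₂ * u₁) - xyDet φ u₁ u₂ • (u * u) ∈
      J ^ 3 := by
    refine h.mem_cube (sub_mem (Submodule.smul_mem _ _ (sub_mem (mul_mem_sq h₁.2.1 h₂.2.1)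
      (mul_mem_sq h₂.2.1 h₁.2.1))) (Submodule.smul_mem _ _ (mul_mem_sq hu.2.1 hu.2.1))) ?_
    rw [map_sub, map_smul, map_smul, map_sub, h.map_mul_of_mem h₁.2.1 h₂.2.1,
      h.map_mul_of_mem h₂.2.1 h₁.2.1, h.map_mul_of_mem hu.2.1 hu.2.1]
    ext <;> simp only [QuadAlg.sub_def, QuadAlg.smul_def, QuadAlg.zero_def, xyDet]
    any_goals ring1
    · linear_combination (-((φ u).x + (φ u).y) * (φ u).x * (φ u₁).x * (φ u₂).y) * h2
    · linear_combination (-((φ u₁).x * (φ u₂).y + (φ u₁).y * (φ u₂).x) *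
        (φ u).x * (φ u).y) * h2
    · linear_combination (-((φ u₁).x * (φ u₂).y + (φ u₁).y * (φ u₂).x) *
        (φ u).x * (φ u).w) * h2
    · linear_combination (-((φ u₁).x * (φ u₂).y + (φ u₁).y * (φ u₂).x) *
        (φ u).y * (φ u).w) * h2
  have := f3 _ hmem
  rw [map_sub, map_smul, map_smul, map_sub, f1, f2 _ (hB.mul_eq_zero_or_mem _ hu.1 _ hu.1) hne,
    f2 _ (hB.mul_eq_zero_or_mem _ h₂.1 _ h₁.1)
      (h.mul_ne_mul_of_xyDet_ne_zero h₁.2.1 h₂.2.1 hdet)] at this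
  simpa using this

lemma eq_of_xyDet_ne_zero (h : QuadApprox φ J x y w) (hB : IsAdaptedBasis B J) [CharP K 2]
    {u₁ u₂ u₃ : A} (h₁ : u₁ ∈ adaptedGenerators B J) (h₂ : u₂ ∈ adaptedGenerators B J)
    (h₃ : u₃ ∈ adaptedGenerators B J) (h₁₂ : xyDet φ u₁ u₂ ≠ 0) (h₁₃ : xyDet φ u₁ u₃ ≠ 0) :
    u₂ = u₃ := by
  have h2 : (2 : K) = 0 := CharTwo.two_eq_zero
  have s₁ := h.square_coeff_eq_zero hB h₁ h₂ h₁₂ h₁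
  have s₂ := h.square_coeff_eq_zero hB h₁ h₂ h₁₂ h₂
  have s₃ := h.square_coeff_eq_zero hB h₁ h₂ h₁₂ h₃
  obtain ⟨hb, hb3⟩ := h.mul_mem_of_xyDet_ne_zero hB h₁ h₂ h₁₂
  have hor : u₁ * u₂ = u₁ * u₃ ∨ u₁ * u₂ = u₃ * u₁ := by
    by_contra! hcon
    obtain ⟨f, f1, f2, f3⟩ := hB.exists_coord 2 hb hb3
    have hmem : xyDet φ u₁ u₃ • (u₁ * u₂ - u₂ * u₁) - xyDet φ u₁ u₂ • (u₁ * u₃ - u₃ * u₁) ∈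
        J ^ 3 := by
      refine h.mem_cube (sub_mem (Submodule.smul_mem _ _ (sub_mem (mul_mem_sq h₁.2.1 h₂.2.1)
        (mul_mem_sq h₂.2.1 h₁.2.1))) (Submodule.smul_mem _ _ (sub_mem (mul_mem_sq h₁.2.1 h₃.2.1)
        (mul_mem_sq h₃.2.1 h₁.2.1)))) ?_
      rw [map_sub, map_smul, map_smul, map_sub, map_sub, h.map_mul_of_mem h₁.2.1 h₂.2.1,
        h.map_mul_of_mem h₂.2.1 h₁.2.1, h.map_mul_of_mem h₁.2.1 h₃.2.1,
        h.map_mul_of_mem h₃.2.1 h₁.2.1]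
      ext <;> simp only [QuadAlg.sub_def, QuadAlg.smul_def, QuadAlg.zero_def, xyDet]
      any_goals ring1
      linear_combination (φ u₁).x * (φ u₁).y *
        ((φ u₂).x * (φ u₃).y - (φ u₂).y * (φ u₃).x) * h2
    have := f3 _ hmem
    rw [map_sub, map_smul, map_smul, map_sub, map_sub, f1,
      f2 _ (hB.mul_eq_zero_or_mem _ h₂.1 _ h₁.1)
        (h.mul_ne_mul_of_xyDet_ne_zero h₁.2.1 h₂.2.1 h₁₂),
      f2 _ (hB.mul_eq_zero_or_mem _ h₁.1 _ h₃.1) hcon.1.symm,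
      f2 _ (hB.mul_eq_zero_or_mem _ h₃.1 _ h₁.1) hcon.2.symm] at this
    simp [h₁₃] at this
  have hcoord : (φ u₂).x = (φ u₃).x ∧ (φ u₂).y = (φ u₃).y ∧ (φ u₂).w = (φ u₃).w := by
    have hφ := hor.imp (congrArg φ) (congrArg φ)
    rw [h.map_mul_of_mem h₁.2.1 h₂.2.1, h.map_mul_of_mem h₁.2.1 h₃.2.1,
      h.map_mul_of_mem h₃.2.1 h₁.2.1] at hφ
    simp only [QuadAlg.mk.injEq, true_and] at hφ
    simp only [xyDet] at h₁₂ h₁₃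
    have e (s t : K) (hst : s + t = 0) : t = s := by linear_combination hst - s * h2
    rcases mul_eq_zero.1 s₁ with s₁ | s₁
    · have s₁ := e _ _ s₁
      rw [s₁] at h₁₂ h₁₃ hφ
      have hx : (φ u₁).x ≠ 0 := by rintro h0; simp [h0] at h₁₂
      rcases mul_eq_zero.1 s₂ with s₂ | s₂
      · exact absurd (by linear_combination (φ u₁).x * s₂) h₁₂
      rcases mul_eq_zero.1 s₃ with s₃ | s₃
      · exact absurd (by linear_combination (φ u₁).x * s₃) h₁₃
      simp only [s₂, s₃, mul_zero, zero_mul, zero_add, add_zero, mul_eq_mul_left_iff, hx, or_false]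
        at h₁₂ h₁₃ hφ ⊢
      rcases hφ with hφ | hφ
      · exact ⟨trivial, hφ.2.1, hφ.2.2.1⟩
      · exact absurd (by linear_combination -hφ.1) h₁₃
    · have hy : (φ u₁).y ≠ 0 := by rintro h0; simp [h0, s₁] at h₁₂
      simp only [s₁, mul_zero, zero_mul, zero_add, add_zero, mul_eq_mul_left_iff, hy, or_false]
        at h₁₂ h₁₃ hφ
      have hx₂ := right_ne_zero_of_mul h₁₂
      have hx₃ := right_ne_zero_of_mul h₁₃
      have s₂ := e _ _ ((mul_eq_zero.1 s₂).resolve_right hx₂)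
      have s₃ := e _ _ ((mul_eq_zero.1 s₃).resolve_right hx₃)
      rcases hφ with hφ | hφ
      · have hx := hφ.1
        refine ⟨hx, by rw [s₂, s₃, hx], ?_⟩
        have := hφ.2.2.2
        rw [s₂, s₃, hx] at this
        exact mul_left_cancel₀ hy (add_right_cancel this)
      · exact absurd hφ.1 h₁₂
  refine hB.eq_of_sub_mem 1 h₂.1 h₂.2.2 (Or.inr h₃.1)
    (h.mem_sq (sub_mem h₂.2.1 h₃.2.1) ?_ ?_ ?_) <;>
  simp [map_sub, hcoord]

/-- In an adapted basis there is a generator, congruent to a nonzero multiple of `w` modulo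
`J ^ 2`, that commutes with every generator. -/
lemma exists_commuting_generator (h : QuadApprox φ J x y w) (hB : IsAdaptedBasis B J)
    [CharP K 2] : ∃ u ∈ J, (φ u).w ≠ 0 ∧ ∀ v ∈ adaptedGenerators B J, Commute u v := by
  have h2 : (2 : K) = 0 := CharTwo.two_eq_zero
  obtain ⟨u₁, h₁, u₂, h₂, hdet⟩ := h.exists_xyDet_ne_zero hB
  obtain ⟨u₃, h₃, hne₁, hne₂⟩ := h.exists_third hB hdet
  have h₁₃ : xyDet φ u₁ u₃ = 0 := by
    by_contra h0
    exact hne₂ (h.eq_of_xyDet_ne_zero hB h₁ h₂ h₃ hdet h0).symm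
  have h₂₃ : xyDet φ u₂ u₃ = 0 := by
    by_contra h0
    exact hne₁ (h.eq_of_xyDet_ne_zero hB h₂ h₁ h₃ (by rwa [xyDet_comm]) h0).symm
  have hx : (φ u₃).x = 0 := by
    refine (mul_eq_zero.1 ?_).resolve_left hdet
    simp only [xyDet] at *
    linear_combination (φ u₂).x * h₁₃ - (φ u₁).x * h₂₃ + (φ u₁).x * (φ u₂).y * (φ u₃).x * h2
  have hy : (φ u₃).y = 0 := by
    refine (mul_eq_zero.1 ?_).resolve_left hdet
    simp only [xyDet] at *
    linear_combination (φ u₂).y * h₁₃ - (φ u₁).y * h₂₃ + (φ u₁).y * (φ u₂).x * (φ u₃).y * h2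
  have hw : (φ u₃).w ≠ 0 := fun hw => h₃.2.2 (h.mem_sq h₃.2.1 hx hy hw)
  refine ⟨u₃, h₃.2.1, hw, fun v hv => ?_⟩
  by_cases hvu : v = u₃
  · rw [hvu]
  have hφ : φ (u₃ * v) = φ (v * u₃) := by
    rw [h.map_mul_of_mem h₃.2.1 hv.2.1, h.map_mul_of_mem hv.2.1 h₃.2.1]
    ext <;> simp [hx, hy, mul_comm]
  have hφ0 : φ (u₃ * v) ≠ 0 := by
    intro h0
    rw [h.map_mul_of_mem h₃.2.1 hv.2.1] at h0
    simp [hx, hy, hw] at h0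
    have hmem : (φ u₃).w • v - (φ v).w • u₃ ∈ J ^ 2 := by
      refine h.mem_sq (sub_mem (J.smul_mem _ hv.2.1) (J.smul_mem _ h₃.2.1)) ?_ ?_ ?_ <;>
      simp [map_sub, map_smul, h0, hx, hy, mul_comm]
    obtain ⟨f, f1, f2, f3⟩ := hB.exists_coord 1 hv.1 hv.2.2
    have := f3 _ hmem
    rw [map_sub, map_smul, map_smul, f1, f2 u₃ (Or.inr h₃.1) (Ne.symm hvu)] at this
    simp [hw] at this
  refine h.eq_of_map_eq hB ?_ (mul_mem_sq h₃.2.1 hv.2.1) hφ0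
    (hB.mul_eq_zero_or_mem _ hv.1 _ h₃.1) (mul_mem_sq hv.2.1 h₃.2.1) hφ
  refine (hB.mul_eq_zero_or_mem _ h₃.1 _ hv.1).resolve_left fun h0 => hφ0 ?_
  rw [h0, map_zero]

/-- If `J` is nilpotent, the generator of `exists_commuting_generator` commutes with `J`. -/
lemma exists_forall_commute (h : QuadApprox φ J x y w) (hB : IsAdaptedBasis B J)
    [CharP K 2] {N : ℕ} (hN : J ^ N = ⊥) : ∃ u, (φ u).w ≠ 0 ∧ ∀ v ∈ J, Commute u v := by
  obtain ⟨u, -, hw, hcomm⟩ := h.exists_commuting_generator hB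
  refine ⟨u, hw, ?_⟩
  let Z : Submodule K A := (Subalgebra.toSubmodule (Subalgebra.centralizer K {u})) ⊓ J
  have hZ (v : A) : v ∈ Z ↔ Commute u v ∧ v ∈ J := by
    simp [Z, Subalgebra.mem_centralizer_iff, commute_iff_eq]
  have hsq : J ≤ Z ⊔ J ^ 2 := by
    conv_lhs => rw [← hB.span_inter]
    refine Submodule.span_le.2 fun v hv => ?_
    rcases mem_or_mem_sq hv with hv | hv
    · exact Submodule.mem_sup_left ((hZ v).2 ⟨hcomm v hv, hv.2.1⟩)
    · exact Submodule.mem_sup_right hv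
  have hZZ : Z * Z ≤ Z := Submodule.mul_le.2 fun p hp q hq => by
    rw [hZ] at hp hq ⊢
    exact ⟨hp.1.mul_right hq.1, h.sq_le (mul_mem_sq hp.2 hq.2)⟩
  have hZJ : Z ≤ J := inf_le_right
  have hpow (k : ℕ) : J ≤ Z ⊔ J ^ (k + 2) := by
    induction k with
    | zero => exact hsq
    | succ k ih =>
      refine hsq.trans (sup_le le_sup_left ?_)
      calc J ^ 2 = J * J := pow_two J
        _ ≤ (Z ⊔ J ^ (k + 2)) * J := mul_le_mul' ih le_rfl
        _ = Z * J ⊔ J ^ (k + 3) := by rw [Submodule.sup_mul, ← pow_succ]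
        _ ≤ Z * (Z ⊔ J ^ (k + 2)) ⊔ J ^ (k + 3) := sup_le_sup_right (mul_le_mul' le_rfl ih) _
        _ ≤ Z ⊔ J ^ (k + 3) := by
          rw [Submodule.mul_sup, sup_assoc]
          refine sup_le_sup hZZ (sup_le ?_ le_rfl)
          rw [pow_succ' J (k + 2)]
          exact mul_le_mul' hZJ le_rfl
  intro v hv
  have := hpow N hv
  rw [pow_add, hN, Submodule.bot_mul, sup_bot_eq, hZ] at this
  exact this.1

end QuadApprox

end Approximation

section GroupAlgebra

open MonoidAlgebra

variable (K : Type*) [Field K] (G : Type*) [Group G]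

/-- The augmentation ideal of a group algebra. -/
noncomputable def augmentationIdeal : Ideal (MonoidAlgebra K G) :=
  RingHom.ker (lift K K G (1 : G →* K))

/-- The augmentation ideal as a `K`-subspace. -/
noncomputable def augmentationSubmodule : Submodule K (MonoidAlgebra K G) :=
  (augmentationIdeal K G).restrictScalars K

variable {K G}

lemma mem_augmentationSubmodule {u : MonoidAlgebra K G} :
    u ∈ augmentationSubmodule K G ↔ lift K K G (1 : G →* K) u = 0 := Iff.rfl

lemma of_sub_one_mem (g : G) : of K G g - 1 ∈ augmentationSubmodule K G := by
  simp [mem_augmentationSubmodule]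

lemma mul_mem_augmentationSubmodule {u : MonoidAlgebra K G} (hu : u ∈ augmentationSubmodule K G)
    (v : MonoidAlgebra K G) : u * v ∈ augmentationSubmodule K G := by
  rw [mem_augmentationSubmodule] at *
  rw [map_mul, hu, zero_mul]

lemma augmentationSubmodule_le {L : Submodule K (MonoidAlgebra K G)}
    (hL : ∀ g, of K G g - 1 ∈ L) : augmentationSubmodule K G ≤ L := by
  have key (u : MonoidAlgebra K G) : u - (lift K K G (1 : G →* K) u) • 1 ∈ L := by
    induction u using MonoidAlgebra.induction_on with
    | of g => simpa using hL g
    | add p q hp hq =>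
      convert add_mem hp hq using 1
      rw [map_add]; module
    | smul r p hp =>
      convert L.smul_mem r hp using 1
      rw [map_smul, smul_eq_mul]; module
  intro u hu
  have := key u
  rwa [mem_augmentationSubmodule.1 hu, zero_smul, sub_zero] at this

lemma augmentationSubmodule_le_sup {a c d : G}
    (hgen : Subgroup.closure {a, c, d} = (⊤ : Subgroup G)) :
    augmentationSubmodule K G ≤ Submodule.span K {of K G a - 1, of K G c - 1, of K G d - 1} ⊔
      augmentationSubmodule K G ^ 2 := by
  refine augmentationSubmodule_le fun g => ?_
  have hmul (p q : G) : (of K G p - 1) * (of K G q - 1) ∈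
      Submodule.span K {of K G a - 1, of K G c - 1, of K G d - 1} ⊔
      augmentationSubmodule K G ^ 2 := by
    refine Submodule.mem_sup_right ?_
    rw [pow_two]
    exact Submodule.mul_mem_mul (of_sub_one_mem p) (of_sub_one_mem q)
  have hg : g ∈ Subgroup.closure {a, c, d} := hgen ▸ Subgroup.mem_top g
  induction hg using Subgroup.closure_induction with
  | mem g hg =>
    refine Submodule.mem_sup_left (Submodule.subset_span ?_)
    rcases hg with rfl | rfl | rfl <;> simp
  | one => rw [map_one, sub_self]; exact zero_mem _
  | mul p q _ _ hp hq =>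
    convert add_mem (hmul p q) (add_mem hp hq) using 1
    rw [map_mul]; noncomm_ring
  | inv p _ hp =>
    convert neg_mem (add_mem (hmul p⁻¹ p) hp) using 1
    have h1 : of K G p⁻¹ * of K G p = 1 := by rw [← map_mul, inv_mul_cancel, map_one]
    rw [sub_mul, mul_sub, h1]; noncomm_ring

lemma two_eq_zero [CharP K 2] : (2 : MonoidAlgebra K G) = 0 := by
  rw [← map_ofNat (algebraMap K (MonoidAlgebra K G)) 2, CharTwo.two_eq_zero, map_zero]

lemma of_sub_one_pow [CharP K 2] (g : G) (k : ℕ) :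
    (of K G g - 1) ^ 2 ^ k = of K G (g ^ 2 ^ k) - 1 := by
  induction k with
  | zero => simp
  | succ k ih =>
    rw [pow_succ, pow_mul, ih, pow_mul, map_pow _ (g ^ 2 ^ k)]
    set p := of K G (g ^ 2 ^ k)
    have h : (p - 1) ^ 2 = p ^ 2 - 1 + 2 * (1 - p) := by noncomm_ring
    rw [h, two_eq_zero, zero_mul, add_zero]

/-- The subgroup of elements of `G` acting trivially on the class of `v` modulo a left ideal. -/
noncomputable def fixer (M : Ideal (MonoidAlgebra K G)) (v : MonoidAlgebra K G) : Subgroup G where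
  carrier := {g | of K G g * v - v ∈ M}
  one_mem' := by
    change of K G 1 * v - v ∈ M
    rw [map_one, one_mul, sub_self]; exact zero_mem _
  mul_mem' {g h} hg hh := by
    have := add_mem (M.mul_mem_left (of K G g) hh) hg
    change of K G (g * h) * v - v ∈ M
    convert this using 1
    rw [map_mul]; noncomm_ring
  inv_mem' {g} hg := by
    have := neg_mem (M.mul_mem_left (of K G g⁻¹) hg)
    change of K G g⁻¹ * v - v ∈ M
    convert this using 1
    have h1 : of K G g⁻¹ * of K G g = 1 := by rw [← map_mul, inv_mul_cancel, map_one]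
    rw [mul_sub, ← mul_assoc, h1, one_mul, neg_sub]

lemma mem_fixer {M : Ideal (MonoidAlgebra K G)} {v : MonoidAlgebra K G} {g : G} :
    g ∈ fixer M v ↔ of K G g * v - v ∈ M := Iff.rfl

/-- A `2`-element normalizing a subgroup that fixes a nonzero vector fixes a nonzero vector of
the fixed space of that subgroup. -/
lemma exists_fixer_ge [CharP K 2] {M : Ideal (MonoidAlgebra K G)} {v : MonoidAlgebra K G}
    (hv : v ∉ M) {S : Set G} (hS : S ⊆ fixer M v) {t : G} {k : ℕ} (ht : t ^ 2 ^ k = 1)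
    (hnorm : ∀ s ∈ S, t⁻¹ * s * t ∈ Subgroup.closure S) :
    ∃ v' ∉ M, S ⊆ fixer M v' ∧ t ∈ fixer M v' := by
  classical
  have hstab (n : ℕ) : S ⊆ fixer M ((of K G t - 1) ^ n * v) := by
    induction n with
    | zero => simpa using hS
    | succ n ih =>
      intro s hs
      set u := (of K G t - 1) ^ n * v
      have h1 : of K G (t⁻¹ * s * t) * u - u ∈ M := ((Subgroup.closure_le _).2 ih) (hnorm s hs)
      have h2 : of K G s * u - u ∈ M := ih hs
      have h3 := sub_mem (M.mul_mem_left (of K G t) h1) h2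
      rw [SetLike.mem_coe, mem_fixer, pow_succ', mul_assoc]
      convert h3 using 1
      have : of K G t * of K G (t⁻¹ * s * t) = of K G s * of K G t := by
        rw [← map_mul, ← map_mul]; congr 1; group
      change of K G s * ((of K G t - 1) * u) - (of K G t - 1) * u = _
      rw [mul_sub (of K G t), ← mul_assoc (of K G t), this]
      noncomm_ring
  have hex : ∃ n, (of K G t - 1) ^ n * v ∈ M := ⟨2 ^ k, by
    rw [of_sub_one_pow, ht, map_one, sub_self, zero_mul]; exact zero_mem _⟩
  obtain ⟨n, hn⟩ : ∃ n, Nat.find hex = n + 1 := by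
    refine Nat.exists_eq_succ_of_ne_zero fun h0 => hv ?_
    have := Nat.find_spec hex
    rw [h0] at this
    simpa using this
  refine ⟨(of K G t - 1) ^ n * v, Nat.find_min hex (by omega), hstab n, ?_⟩
  have := Nat.find_spec hex
  rw [hn, pow_succ', mul_assoc] at this
  rw [mem_fixer]
  convert this using 1
  rw [sub_mul (of K G t), one_mul]

lemma augmentationIdeal_isMaximal : (augmentationIdeal K G).IsMaximal :=
  RingHom.ker_isMaximal_of_surjective _ fun r => ⟨algebraMap K _ r, AlgHom.commutes _ r⟩

lemma augmentationIdeal_le_of_fixer_eq_top {M : Ideal (MonoidAlgebra K G)} (hM : M.IsMaximal)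
    {v : MonoidAlgebra K G} (hv : v ∉ M) (hfix : fixer M v = ⊤) :
    augmentationIdeal K G ≤ M := by
  have hJ (u : MonoidAlgebra K G) (hu : u ∈ augmentationSubmodule K G) : u * v ∈ M := by
    let L : Submodule K (MonoidAlgebra K G) :=
      (M.restrictScalars K).comap (LinearMap.mulRight K v)
    refine augmentationSubmodule_le (L := L) (fun g => ?_) hu
    have : g ∈ fixer M v := hfix ▸ Subgroup.mem_top g
    change (of K G g - 1) * v ∈ M
    rwa [sub_mul, one_mul]
  have htop : M ⊔ Ideal.span {v} = ⊤ :=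
    hM.1.2 _ (lt_of_le_of_ne le_sup_left fun h => hv
      (h ▸ Submodule.mem_sup_right (Ideal.subset_span rfl)))
  obtain ⟨m, hm, n, hn, hmn⟩ := Submodule.mem_sup.1 (htop ▸ Submodule.mem_top :
    (1 : MonoidAlgebra K G) ∈ M ⊔ Ideal.span {v})
  obtain ⟨r, rfl⟩ := Ideal.mem_span_singleton'.1 hn
  intro u hu
  rw [← mul_one u, ← hmn, mul_add, ← mul_assoc]
  exact add_mem (M.mul_mem_left u hm) (hJ _ (mul_mem_augmentationSubmodule hu r))

lemma jacobson_bot_eq_augmentationIdeal [CharP K 2] {a c d : G} {k : ℕ} {r s : ℤ}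
    (hgen : Subgroup.closure {a, c, d} = (⊤ : Subgroup G))
    (ha : a ^ 2 ^ k = 1) (hc : c * c = 1) (hd : d * d = 1)
    (hdc : d * c = c * d) (hda : d * a = a ^ r * d) (hca : c * a = a ^ s * c) :
    (⊥ : Ideal (MonoidAlgebra K G)).jacobson = augmentationIdeal K G := by
  have hcinv := inv_eq_of_mul_eq_one_left hc
  have hdinv := inv_eq_of_mul_eq_one_left hd
  refine le_antisymm (sInf_le ⟨bot_le, augmentationIdeal_isMaximal⟩) (le_sInf ?_)
  rintro M ⟨-, hM⟩
  obtain ⟨v₁, hv₁, -, ha₁⟩ := exists_fixer_ge (M := M) (v := 1) (S := ∅)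
    (fun h1 => hM.1.1 ((Ideal.eq_top_iff_one _).2 h1)) (by simp) ha (by simp)
  obtain ⟨v₂, hv₂, ha₂, hc₂⟩ := exists_fixer_ge (k := 1) (t := c) hv₁
    (Set.singleton_subset_iff.2 ha₁) (by simpa [pow_two] using hc) (by
      rintro _ rfl
      rw [hcinv, hca, mul_assoc, hc, mul_one]
      exact zpow_mem (Subgroup.subset_closure (by simp)) _)
  obtain ⟨v₃, hv₃, hac₃, hd₃⟩ := exists_fixer_ge (k := 1) (t := d) (S := {a, c}) hv₂
    (by rintro _ (rfl | rfl); exacts [ha₂ rfl, hc₂]) (by simpa [pow_two] using hd) (by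
      rintro _ (rfl | rfl)
      · rw [hdinv, hda, mul_assoc, hd, mul_one]
        exact zpow_mem (Subgroup.subset_closure (by simp)) _
      · rw [hdinv, hdc, mul_assoc, hd, mul_one]
        exact Subgroup.subset_closure (by simp))
  refine augmentationIdeal_le_of_fixer_eq_top hM hv₃ (eq_top_iff.2 ?_)
  rw [← hgen, Subgroup.closure_le]
  rintro _ (rfl | rfl | rfl)
  exacts [hac₃ (by simp), hac₃ (by simp), hd₃]

lemma exists_augmentationSubmodule_pow_eq_bot [Finite G]
    (hjac : (⊥ : Ideal (MonoidAlgebra K G)).jacobson = augmentationIdeal K G) :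
    ∃ N, augmentationSubmodule K G ^ N = ⊥ := by
  have : IsArtinianRing (MonoidAlgebra K G) := IsArtinianRing.of_finite K _
  obtain ⟨N, hN⟩ := IsSemiprimaryRing.isNilpotent (R := MonoidAlgebra K G)
  rw [← Ideal.jacobson_bot, hjac] at hN
  have hle (k : ℕ) : augmentationSubmodule K G ^ k ≤
      (augmentationIdeal K G ^ k).restrictScalars K := by
    induction k with
    | zero =>
      rw [pow_zero, Submodule.pow_zero, Submodule.one_le, Submodule.restrictScalars_mem,
        Submodule.one_eq_span]
      exact Submodule.subset_span rfl
    | succ k ih =>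
      rw [pow_succ, Submodule.pow_succ]
      exact Submodule.mul_le.2 fun p hp q hq => Ideal.mul_mem_mul (ih hp) hq
  refine ⟨N, le_bot_iff.1 ((hle N).trans ?_)⟩
  rw [hN]
  exact le_rfl

end GroupAlgebra

namespace QuadAlg

variable {K : Type*} [Field K] [CharP K 2]

/-- The unit `1 + x`. -/
def unitX : (QuadAlg K)ˣ :=
  Units.ofPowEqOne ⟨1, 1, 0, 0, 0, 0, 0, 0⟩ 4
    (by ext <;> simp [pow_succ, CharTwo.add_self_eq_zero]) (by norm_num)

/-- The unit `1 + y`. -/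
def unitY : (QuadAlg K)ˣ :=
  Units.ofPowEqOne ⟨1, 0, 1, 0, 0, 0, 0, 0⟩ 2
    (by ext <;> simp [pow_succ, CharTwo.add_self_eq_zero]) (by norm_num)

/-- The unit `1 + w`. -/
def unitW : (QuadAlg K)ˣ :=
  Units.ofPowEqOne ⟨1, 0, 0, 1, 0, 0, 0, 0⟩ 2
    (by ext <;> simp [pow_succ, CharTwo.add_self_eq_zero]) (by norm_num)

@[simp] lemma coe_unitX : ((unitX : (QuadAlg K)ˣ) : QuadAlg K) = ⟨1, 1, 0, 0, 0, 0, 0, 0⟩ := rfl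

@[simp] lemma coe_unitY : ((unitY : (QuadAlg K)ˣ) : QuadAlg K) = ⟨1, 0, 1, 0, 0, 0, 0, 0⟩ := rfl

@[simp] lemma coe_unitW : ((unitW : (QuadAlg K)ˣ) : QuadAlg K) = ⟨1, 0, 0, 1, 0, 0, 0, 0⟩ := rfl

lemma unitX_pow_four : (unitX : (QuadAlg K)ˣ) ^ 4 = 1 := Units.pow_ofPowEqOne _ _

lemma unitX_pow {k : ℕ} (hk : 2 ≤ k) : (unitX : (QuadAlg K)ˣ) ^ 2 ^ k = 1 := by
  obtain ⟨j, rfl⟩ := Nat.exists_eq_add_of_le hk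
  rw [pow_add, pow_mul]
  norm_num [unitX_pow_four]

lemma unitX_zpow {k : ℕ} (hk : 2 ≤ k) : (unitX : (QuadAlg K)ˣ) ^ (2 ^ k : ℤ) = 1 := by
  exact_mod_cast unitX_pow (K := K) hk

lemma unitX_mul_unitY_mul_unitX : (unitX * unitY * unitX : (QuadAlg K)ˣ) = unitY := by
  ext <;> simp [CharTwo.add_self_eq_zero]

end QuadAlg

section PresentedGroup

open MonoidAlgebra

variable {K : Type*} [Field K] {G : Type*} [Group G] {a c d : G} {k : ℕ}

lemma mul_mem_augmentationSubmodule_pow {n : ℕ} {u : MonoidAlgebra K G}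
    (hu : u ∈ augmentationSubmodule K G ^ (n + 1)) (v : MonoidAlgebra K G) :
    u * v ∈ augmentationSubmodule K G ^ (n + 1) := by
  rw [pow_succ] at hu ⊢
  induction hu using Submodule.mul_induction_on' with
  | mem_mul_mem p hp q hq =>
    rw [mul_assoc]
    exact Submodule.mul_mem_mul hp (mul_mem_augmentationSubmodule hq v)
  | add p _ q _ hp hq => rw [add_mul]; exact add_mem hp hq

lemma of_pow_sub_one_mem [CharP K 2] (g : G) (hk : 2 ≤ k) :
    of K G (g ^ 2 ^ k) - 1 ∈ augmentationSubmodule K G ^ 3 := by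
  obtain ⟨j, hj⟩ : ∃ j, 2 ^ k = 3 + j :=
    Nat.exists_eq_add_of_le ((by norm_num : 3 ≤ 2 ^ 2).trans (Nat.pow_le_pow_right two_pos hk))
  rw [← of_sub_one_pow, hj, pow_add]
  exact mul_mem_augmentationSubmodule_pow (Submodule.pow_mem_pow _ (of_sub_one_mem g) 3) _

lemma of_sub_one_mul_self [CharP K 2] {g : G} (hg : g * g = 1) :
    (of K G g - 1) * (of K G g - 1) = 0 := by
  have := of_sub_one_pow (K := K) g 1
  rwa [pow_one, pow_two, pow_two, hg, map_one, sub_self] at this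

lemma exists_quadApprox [CharP K 2] (hk : 1 ≤ k) (hcard : Nat.card G = 2 ^ (k + 2) * 4)
    (hgen : Subgroup.closure {a, c, d} = (⊤ : Subgroup G))
    (ha : a ^ 2 ^ (k + 2) = 1) (hc : c * c = 1) (hd : d * d = 1) (hdc : d * c = c * d)
    (hda : d * a = a ^ (2 ^ (k + 1) + 1 : ℤ) * d) (hca : c * a = a ^ (2 ^ (k + 1) - 1 : ℤ) * c) :
    ∃ φ : MonoidAlgebra K G →ₐ[K] QuadAlg K, QuadApprox φ (augmentationSubmodule K G)
      (of K G a - 1) (of K G c - 1) (of K G d - 1) := by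
  have hX := QuadAlg.unitX_zpow (K := K) (k := k + 1) (by omega)
  obtain ⟨f, hfa, hfc, hfd⟩ := exists_monoidHom_of_card_eq (by positivity) hcard hgen ha hc hd
    hdc hda hca (a' := QuadAlg.unitX (K := K)) (c' := QuadAlg.unitY) (d' := QuadAlg.unitW)
    (QuadAlg.unitX_pow (by omega))
    (by ext <;> simp [CharTwo.add_self_eq_zero]) (by ext <;> simp [CharTwo.add_self_eq_zero])
    (by ext <;> simp) (by rw [zpow_add_one, hX, one_mul]; ext <;> simp)
    (by rw [zpow_sub_one, hX, one_mul, eq_inv_mul_iff_mul_eq, ← mul_assoc,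
      QuadAlg.unitX_mul_unitY_mul_unitX])
  let φ : MonoidAlgebra K G →ₐ[K] QuadAlg K :=
    lift K (QuadAlg K) G ((Units.coeHom _).comp f)
  have hφ (g : G) : φ (of K G g) = f g := lift_of _ _
  have hz : of K G (a ^ 2 ^ (k + 1)) - 1 ∈ augmentationSubmodule K G ^ 3 :=
    of_pow_sub_one_mem a (by omega)
  have haug : QuadAlg.aug.comp φ = lift K K G (1 : G →* K) := by
    refine algHom_ext' (MonoidHom.eq_of_eqOn_dense hgen ?_) (by ext)
    rintro _ (rfl | rfl | rfl) <;> simp [φ, hfa, hfc, hfd, QuadAlg.aug_apply]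
  refine ⟨φ, ?_, ?_, ?_, ?_, augmentationSubmodule_le_sup hgen, of_sub_one_mul_self hc,
    of_sub_one_mul_self hd, ?_, ?_, ?_⟩
  · intro u
    rw [mem_augmentationSubmodule, ← haug]
    rfl
  · rw [map_sub, hφ, hfa, map_one]; ext <;> simp
  · rw [map_sub, hφ, hfc, map_one]; ext <;> simp
  · rw [map_sub, hφ, hfd, map_one]; ext <;> simp
  · have : of K G d * of K G c = of K G c * of K G d := by rw [← map_mul, hdc, map_mul]
    rw [sub_mul, mul_sub, mul_sub, sub_mul, this]
    noncomm_ring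
  · have h1 : of K G d * of K G a = of K G (a ^ 2 ^ (k + 1)) * (of K G a * of K G d) := by
      rw [← map_mul, hda, zpow_add_one, ← map_mul, ← map_mul, mul_assoc]
      norm_cast
    convert mul_mem_augmentationSubmodule_pow hz (of K G a * of K G d) using 1
    rw [sub_mul _ _ (of K G a * of K G d), ← h1]
    noncomm_ring
  · set p := of K G a
    set q := of K G (a⁻¹ * c)
    have h1 : of K G c * p = of K G (a ^ 2 ^ (k + 1)) * q := by
      rw [← map_mul, hca, zpow_sub_one, ← map_mul, mul_assoc]
      norm_cast
    have h2 : p * q = of K G c := by rw [← map_mul, mul_inv_cancel_left]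
    have h3 : (p - 1) * (p - 1) * (q - 1) ∈ augmentationSubmodule K G ^ 3 := by
      rw [pow_succ, pow_two]
      exact Submodule.mul_mem_mul (Submodule.mul_mem_mul (of_sub_one_mem a) (of_sub_one_mem a))
        (of_sub_one_mem _)
    convert sub_mem (mul_mem_augmentationSubmodule_pow hz q) h3 using 1
    have h4 : (of K G c - 1) * (p - 1) - (p - 1) * (of K G c - 1) - (p - 1) * (p - 1) =
      of K G c * p - p * of K G c - (p - 1) * (p - 1) := by noncomm_ring
    rw [h4, h1, ← h2]
    have h5 : (of K G (a ^ 2 ^ (k + 1)) * q - p * (p * q) - (p - 1) * (p - 1)) =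
      (of K G (a ^ 2 ^ (k + 1)) - 1) * q - (p - 1) * (p - 1) * (q - 1) +
        2 * (q - p * q - (p - 1) * (p - 1)) := by noncomm_ring
    rw [h5, two_eq_zero, zero_mul, add_zero]

lemma coeff_eq_of_commute {u : MonoidAlgebra K G} {g g' h : G} (hu : Commute u (of K G h))
    (hg : h * g = g' * h) : u.coeff g = u.coeff g' := by
  have h1 : (of K G h * u).coeff (h * g) = u.coeff g := by
    rw [of_apply, coeff_single_mul_mul, one_mul]
  have h2 : (u * of K G h).coeff (g' * h) = u.coeff g' := by
    rw [of_apply, coeff_mul_single_mul, mul_one]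
  rw [← h1, hg, ← h2, hu.eq]

/-- An element of `G` outside of `⟨a, c⟩` is conjugate to its product with the central
involution. -/
lemma exists_mul_eq_mul_mul (hgen : Subgroup.closure {a, c, d} = (⊤ : Subgroup G))
    (ha : a ^ 2 ^ (k + 2) = 1) (hc : c * c = 1) (hd : d * d = 1) (hdc : d * c = c * d)
    (hda : d * a = a ^ (2 ^ (k + 1) + 1 : ℤ) * d) (hca : c * a = a ^ (2 ^ (k + 1) - 1 : ℤ) * c)
    (g : G) : (∃ (i : ℤ) (j : Fin 2), g = a ^ i * c ^ (j : ℕ)) ∨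
      ∃ h, h * g = a ^ 2 ^ (k + 1) * g * h := by
  have hzpow {i j : ℤ} (n : ℤ) (h : i = j + 2 ^ (k + 2) * n) : a ^ i = a ^ j := by
    have h1 : a ^ (2 ^ (k + 2) : ℤ) = 1 := by exact_mod_cast ha
    rw [h, zpow_add, zpow_mul, h1, one_zpow, mul_one]
  obtain ⟨i, j, l, rfl⟩ := exists_eq_zpow_mul hc hd hdc hda hca (hgen ▸ Subgroup.mem_top g)
  fin_cases l
  · exact Or.inl ⟨i, j, by simp⟩
  right
  have hz : a ^ 2 ^ (k + 1) = a ^ (2 ^ (k + 1) : ℤ) := by norm_cast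
  fin_cases j
  · refine ⟨a, ?_⟩
    simp only [pow_zero, pow_one, mul_one]
    rw [mul_assoc, mul_assoc _ d, hda, hz, ← mul_assoc, ← mul_assoc, ← mul_assoc, ← zpow_add,
      ← zpow_add, ← zpow_one_add]
    congr 1
    exact hzpow (-1) (by ring)
  · refine ⟨a ^ (2 ^ k : ℤ), ?_⟩
    have h1 : SemiconjBy d (a ^ (2 ^ k : ℤ)) _ := SemiconjBy.zpow_right hda _
    have h2 : SemiconjBy c _ _ := SemiconjBy.zpow_right
      (SemiconjBy.zpow_right hca (2 ^ (k + 1) + 1)) (2 ^ k)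
    simp only [pow_one]
    rw [hz, mul_assoc _ _ (a ^ (2 ^ k : ℤ)), mul_assoc (a ^ i * c) d, h1.eq,
      mul_assoc (a ^ i) c (_ ^ (2 ^ k : ℤ) * d), ← mul_assoc c, h2.eq]
    simp only [← mul_assoc, ← zpow_mul, ← zpow_add]
    congr 2
    exact hzpow (-2 ^ k * 2 ^ k) (by ring)

lemma mul_eq_of_commutator_eq {t y : G} (ht : t * t = 1) (h : t⁻¹ * a⁻¹ * t * a = y) :
    t * a = a * y⁻¹ * t := by
  rw [← h]
  simp [mul_assoc, ht, inv_eq_of_mul_eq_one_left ht]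

lemma pow_ne_one_of_card (hcard : Nat.card G = 2 ^ (k + 2) * 4)
    (hgen : Subgroup.closure {a, c, d} = (⊤ : Subgroup G))
    (hc : c * c = 1) (hd : d * d = 1) (hdc : d * c = c * d)
    (hda : d * a = a ^ (2 ^ (k + 1) + 1 : ℤ) * d) (hca : c * a = a ^ (2 ^ (k + 1) - 1 : ℤ) * c) :
    a ^ 2 ^ (k + 1) ≠ 1 := by
  intro h
  have := (card_closure_le (by positivity) h hc hd hdc hda hca).2
  rw [hgen, Subgroup.card_top, hcard, pow_succ 2 (k + 1)] at this
  have : 0 < 2 ^ (k + 1) := by positivity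
  omega

lemma map_w_eq_zero_of_forall_commute [CharP K 2] [Finite G] (hk : 1 ≤ k)
    (hcard : Nat.card G = 2 ^ (k + 2) * 4)
    (hgen : Subgroup.closure {a, c, d} = (⊤ : Subgroup G))
    (ha : a ^ 2 ^ (k + 2) = 1) (hc : c * c = 1) (hd : d * d = 1) (hdc : d * c = c * d)
    (hda : d * a = a ^ (2 ^ (k + 1) + 1 : ℤ) * d) (hca : c * a = a ^ (2 ^ (k + 1) - 1 : ℤ) * c)
    {φ : MonoidAlgebra K G →ₐ[K] QuadAlg K} (hφ : QuadApprox φ (augmentationSubmodule K G)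
      (of K G a - 1) (of K G c - 1) (of K G d - 1))
    {u : MonoidAlgebra K G} (hu : ∀ g, Commute u (of K G g)) : (φ u).w = 0 := by
  have := Fintype.ofFinite G
  let z := a ^ 2 ^ (k + 1)
  have hz : φ (of K G z) = 1 := by
    have := hφ.map_cube (of_pow_sub_one_mem a (by omega : 2 ≤ k + 1))
    rwa [map_sub, map_one, sub_eq_zero] at this
  have he (g : G) : (φ (of K G g)).e = 1 := by
    have := (hφ.mem_iff _).1 (of_sub_one_mem g)
    rw [map_sub, map_one] at this
    simpa [sub_eq_zero] using this
  let F : G →* Multiplicative K :=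
    { toFun := fun g => Multiplicative.ofAdd (φ (of K G g)).w
      map_one' := by rw [map_one, map_one]; rfl
      map_mul' := fun g h => by
        rw [map_mul, map_mul, ← ofAdd_add, QuadAlg.mul_def]
        simp only [he, one_mul, mul_one, add_comm] }
  have hFa : F a = 1 := by
    have := congrArg QuadAlg.w hφ.map_x
    rw [map_sub, map_one] at this
    exact (by simpa using this : (φ (of K G a)).w = 0)
  have hFc : F c = 1 := by
    have := congrArg QuadAlg.w hφ.map_y
    rw [map_sub, map_one] at this
    exact (by simpa using this : (φ (of K G c)).w = 0)
  have hFz (g : G) : F (z * g) = F g := by rw [map_mul, map_pow, hFa, one_pow, one_mul]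
  have hsum (u : MonoidAlgebra K G) : (φ u).w = ∑ g, u.coeff g * (F g).toAdd := by
    classical
    induction u using MonoidAlgebra.induction_on with
    | of g => simp only [of_apply, coeff_single, Finsupp.single_apply, ite_mul, one_mul, zero_mul,
        Finset.sum_ite_eq, Finset.mem_univ, if_true]; rfl
    | add p q hp hq =>
      simp only [map_add, QuadAlg.add_def, hp, hq, coeff_add, Finsupp.add_apply, add_mul,
        Finset.sum_add_distrib]
    | smul r p hp =>
      simp only [map_smul, QuadAlg.smul_def, hp, coeff_smul, Finsupp.smul_apply, smul_eq_mul,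
        mul_assoc, Finset.mul_sum]
  rw [hsum]
  have hzz : z * z = 1 := by rw [← ha, ← pow_add]; congr 1; ring
  have hterm (g : G) : u.coeff g * (F g).toAdd = u.coeff (z * g) * (F (z * g)).toAdd := by
    rw [hFz]
    rcases exists_mul_eq_mul_mul hgen ha hc hd hdc hda hca g with ⟨i, j, rfl⟩ | ⟨h, hh⟩
    · simp [hFa, hFc]
    · rw [coeff_eq_of_commute (hu h) hh]
  refine Finset.sum_involution (fun g _ => z * g) (fun g _ => ?_) (fun g _ _ h => ?_)
    (fun _ _ => Finset.mem_univ _) (fun g _ => by rw [← mul_assoc, hzz, one_mul])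
  · rw [← hterm, CharTwo.add_self_eq_zero]
  · exact pow_ne_one_of_card hcard hgen hc hd hdc hda hca (mul_eq_right.1 h)

end PresentedGroup

/-- The group `G₁₅ = ⟨a, c, d ∣ a^(2^(m-2)) = c² = d² = 1, (d,c) = 1, (d,a) = a^(2^(m-3)), (c,a) = a^(2+2^(m-3))⟩` of order `2^m`, `m ≥ 5`: in characteristic `2`, `KG` has no filtered multiplicative `K`-basis. -/
theorem no_filtered_mult_basis_G15 (K : Type*) [Field K] [CharP K 2] (m : ℕ) (hm : 5 ≤ m)
    (G : Type*) [Group G] [Fintype G] (hcard : Nat.card G = 2 ^ m)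
    (a c d : G) (hgen : Subgroup.closure {a, c, d} = (⊤ : Subgroup G))
    (ha : a ^ 2 ^ (m - 2) = 1) (hc : c ^ 2 = 1) (hd : d ^ 2 = 1)
    (hdc : d⁻¹ * c⁻¹ * d * c = 1) (hda : d⁻¹ * a⁻¹ * d * a = a ^ 2 ^ (m - 3))
    (hca : c⁻¹ * a⁻¹ * c * a = a ^ 2 * a ^ 2 ^ (m - 3)) :
    ¬ ∃ B : Set (MonoidAlgebra K G), IsFilteredMultiplicativeBasis K B := by
  obtain ⟨k, rfl⟩ := Nat.exists_eq_add_of_le' (by omega : 4 ≤ m)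
  have hk : 1 ≤ k := by omega
  rw [show k + 4 - 2 = k + 2 by omega] at ha
  rw [show k + 4 - 3 = k + 1 by omega] at hda hca
  rw [show 2 ^ (k + 4) = 2 ^ (k + 2) * 4 by ring] at hcard
  have hz2 : a ^ (2 ^ (k + 1) : ℤ) * a ^ (2 ^ (k + 1) : ℤ) = 1 := by
    rw [← zpow_add, ← ha, ← zpow_natCast]
    congr 1
    push_cast
    ring
  have hz : a ^ 2 ^ (k + 1) = a ^ (2 ^ (k + 1) : ℤ) := by norm_cast
  rw [hz] at hda hca
  rw [pow_two] at hc hd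
  have hdc' : d * c = c * d := by simpa using mul_eq_of_commutator_eq hd hdc
  have hda' : d * a = a ^ (2 ^ (k + 1) + 1 : ℤ) * d := by
    rw [mul_eq_of_commutator_eq hd hda, inv_eq_of_mul_eq_one_left hz2, zpow_add_one,
      (Commute.zpow_self a _).eq]
  have hca' : c * a = a ^ (2 ^ (k + 1) - 1 : ℤ) * c := by
    rw [mul_eq_of_commutator_eq hc hca, mul_inv_rev, inv_eq_of_mul_eq_one_left hz2,
      zpow_sub_one, (Commute.zpow_self a _).inv_right.eq]
    group
  rintro ⟨B, hli, hspan, hmul, -, hrad⟩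
  have hjac := jacobson_bot_eq_augmentationIdeal (K := K) hgen ha hc hd hdc' hda' hca'
  obtain ⟨N, hN⟩ := exists_augmentationSubmodule_pow_eq_bot hjac
  rw [hjac] at hrad
  obtain ⟨φ, hφ⟩ := exists_quadApprox (K := K) hk hcard hgen ha hc hd hdc' hda' hca'
  obtain ⟨u, hw, hu⟩ := hφ.exists_forall_commute ⟨hli, hspan, hmul, hrad⟩ hN
  refine hw (map_w_eq_zero_of_forall_commute hk hcard hgen ha hc hd hdc' hda' hca' hφ fun g => ?_)
  have := (hu _ (of_sub_one_mem g)).add_right (Commute.one_right u)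
  rwa [sub_add_cancel] at this
end
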